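/- (Wronski relations.) Let R̂ be a Hecke R-matrix for the parameter q with m_q ≠ 0 for all m ≥ 1, let F̂ be a closed R-matrix compatible with R̂, and let M be a matrix of generators of M(R̂,F̂) over a unital associative k-algebra A. Then for every k ≥ 1: Σ_{i=0}^{k} (−1)^i τ_{k−i}(M) σ_i(M) = 0 in A. -/

import Mathlib

/-! Common definitions for quantum matrix algebras `M(R̂,F̂)` in the sense of
Isaev–Ogievetsky–Pyatov, "On quantum matrix algebras satisfying the
Cayley-Hamilton-Newton identities".

We model operators on `V^{⊗m}` (where `dim V = N`) as matrices indexed by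
multi-indices `Fin m → Fin N`; entries are taken in a (possibly
noncommutative) unital associative algebra `A` over a field `K`.
Sites (tensor factors) are numbered starting from `0`, so the paper's
`X_i` is `site m (i-1) X`, and the paper's `M_{\overline{k}}` is
`Mbar m F F⁻¹ M (k-1)`. -/

namespace CHN

noncomputable section

/-- Operators on `V^{⊗m}` (`dim V = N`) with entries in a ring `A`. -/
abbrev Op (N : ℕ) (A : Type*) [Ring A] (m : ℕ) :=
  Matrix (Fin m → Fin N) (Fin m → Fin N) A

/-- Operators on `V ⊗ V`. -/
abbrev M2 (N : ℕ) (A : Type*) [Ring A] :=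
  Matrix (Fin N × Fin N) (Fin N × Fin N) A

/-- `site m i X` places the two-site operator `X` at the (0-based) tensor
factors `i, i+1` of `V^{⊗m}`, acting as the identity elsewhere.  In the
paper's 1-based notation, `X_i = site m (i-1) X`.  (Out of range it is the
identity.) -/
def site {A : Type*} [Ring A] {N : ℕ} (m i : ℕ) (X : M2 N A) : Op N A m :=
  fun a b =>
    if h : i + 1 < m then
      X (a ⟨i, Nat.lt_of_succ_lt h⟩, a ⟨i + 1, h⟩)
          (b ⟨i, Nat.lt_of_succ_lt h⟩, b ⟨i + 1, h⟩) *
        (if ∀ j : Fin m, (j : ℕ) ≠ i → (j : ℕ) ≠ i + 1 → a j = b j then 1 else 0)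
    else if a = b then 1 else 0

/-- `site1 m i X` places the one-site operator `X` at the (0-based) factor `i`. -/
def site1 {A : Type*} [Ring A] {N : ℕ} (m i : ℕ) (X : Matrix (Fin N) (Fin N) A) :
    Op N A m :=
  fun a b =>
    if h : i < m then
      X (a ⟨i, h⟩) (b ⟨i, h⟩) *
        (if ∀ j : Fin m, (j : ℕ) ≠ i → a j = b j then 1 else 0)
    else if a = b then 1 else 0

/-- `chain m X i l = X_i X_{i+1} ⋯ X_{i+l-1}` (0-based sites, `l` factors); in
the paper's 1-based notation this is `X_{i+1 → i+l}`. -/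
def chain {A : Type*} [Ring A] {N : ℕ} (m : ℕ) (X : M2 N A) (i : ℕ) :
    ℕ → Op N A m
  | 0 => 1
  | l + 1 => chain m X i l * site m (i + l) X

/-- The Yang–Baxter equation `X₁X₂X₁ = X₂X₁X₂` on `V^{⊗3}`. -/
def YB {A : Type*} [Ring A] {N : ℕ} (X : M2 N A) : Prop :=
  site 3 0 X * site 3 1 X * site 3 0 X = site 3 1 X * site 3 0 X * site 3 1 X

/-- Compatibility of a pair of R-matrices: both Yang–Baxter equations together
with the conditions `R̂₁F̂₂F̂₁ = F̂₂F̂₁R̂₂` and `F̂₁F̂₂R̂₁ = R̂₂F̂₁F̂₂` on `V^{⊗3}`. -/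
def Compatible {A : Type*} [Ring A] {N : ℕ} (R F : M2 N A) : Prop :=
  YB R ∧ YB F ∧
    site 3 0 R * site 3 1 F * site 3 0 F = site 3 1 F * site 3 0 F * site 3 1 R ∧
    site 3 0 F * site 3 1 F * site 3 0 R = site 3 1 R * site 3 0 F * site 3 1 F

/-- `Ψ` witnesses closedness of `F̂`:  `Ψ^{af}_{cg} F̂^{gb}_{fd} = δ^a_d δ^b_c`. -/
def IsClosedPair {A : Type*} [Ring A] {N : ℕ} (F Ψ : M2 N A) : Prop :=
  ∀ a b c d : Fin N,
    (∑ f : Fin N, ∑ g : Fin N, Ψ (a, f) (c, g) * F (g, b) (f, d)) =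
      if a = d ∧ b = c then 1 else 0

/-- The matrix `D`, `D^a_b := Ψ^{ac}_{bc}`. -/
def Dmat {A : Type*} [Ring A] {N : ℕ} (Ψ : M2 N A) : Matrix (Fin N) (Fin N) A :=
  fun a b => ∑ c : Fin N, Ψ (a, c) (b, c)

/-- Quantum trace (with weight `D`) over the last tensor factor. -/
def qtr1 {K : Type*} [Field K] {A : Type*} [Ring A] [Algebra K A] {N m : ℕ}
    (D : Matrix (Fin N) (Fin N) K) (X : Op N A (m + 1)) : Op N A m :=
  fun a b => ∑ c : Fin N, ∑ e : Fin N,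
    algebraMap K A (D c e) * X (Fin.snoc a e) (Fin.snoc b c)

/-- Quantum trace over the last `j` tensor factors. -/
def qtrs {K : Type*} [Field K] {A : Type*} [Ring A] [Algebra K A] {N : ℕ}
    (D : Matrix (Fin N) (Fin N) K) (m : ℕ) :
    (j : ℕ) → Op N A (m + j) → Op N A m
  | 0, X => X
  | j + 1, X => qtrs D m j (qtr1 D X)

/-- Full quantum trace `Tr_F(1,…,m)`, with values in `A`. -/
def qtrAll {K : Type*} [Field K] {A : Type*} [Ring A] [Algebra K A] {N m : ℕ}
    (D : Matrix (Fin N) (Fin N) K) (X : Op N A m) : A :=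
  ∑ a : Fin m → Fin N, ∑ b : Fin m → Fin N,
    algebraMap K A (∏ i, D (a i) (b i)) * X b a

/-- Quantum trace of a one-site operator:  `Tr_F X = Tr (D X)`. -/
def trF {K : Type*} [Field K] {A : Type*} [Ring A] [Algebra K A] {N : ℕ}
    (D : Matrix (Fin N) (Fin N) K) (X : Matrix (Fin N) (Fin N) A) : A :=
  ∑ a : Fin N, ∑ b : Fin N, algebraMap K A (D a b) * X b a

/-- Ordinary partial trace over the last tensor factor. -/
def ptr1 {A : Type*} [Ring A] {N m : ℕ} (X : Op N A (m + 1)) : Op N A m :=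
  fun a b => ∑ c : Fin N, X (Fin.snoc a c) (Fin.snoc b c)

/-- Ordinary partial trace over the last `j` tensor factors. -/
def ptrs {A : Type*} [Ring A] {N : ℕ} (m : ℕ) :
    (j : ℕ) → Op N A (m + j) → Op N A m
  | 0, X => X
  | j + 1, X => ptrs m j (ptr1 X)

/-- `Mbar m F Finv M k` is the paper's `M_{\overline{k+1}}` (0-based index `k`):
`M_{\overline{1}} := M₁` and `M_{\overline{k+1}} := F̂_k M_{\overline{k}} F̂_k⁻¹`. -/
def Mbar {A : Type*} [Ring A] {N : ℕ} (m : ℕ) (F Finv : M2 N A)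
    (M : Matrix (Fin N) (Fin N) A) : ℕ → Op N A m
  | 0 => site1 m 0 M
  | k + 1 => site m k F * Mbar m F Finv M k * site m k Finv

/-- `MbarSeg m F Finv M i l = M_{\overline{i+1}} M_{\overline{i+2}} ⋯ M_{\overline{i+l}}`,
the ordered product of `l` consecutive copies starting at 0-based index `i`.
In particular `MbarSeg m F Finv M 0 k = M_{\overline{1}} ⋯ M_{\overline{k}}`. -/
def MbarSeg {A : Type*} [Ring A] {N : ℕ} (m : ℕ) (F Finv : M2 N A)
    (M : Matrix (Fin N) (Fin N) A) (i : ℕ) : ℕ → Op N A m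
  | 0 => 1
  | l + 1 => MbarSeg m F Finv M i l * Mbar m F Finv M (i + l)

/-- The double twist `R̂^{FF} = F̂ (F̂ R̂ F̂⁻¹) F̂⁻¹`. -/
def RFF {K : Type*} [Field K] {N : ℕ} (R F : M2 N K) : M2 N K :=
  F * (F * R * F⁻¹) * F⁻¹

/-- `M` is a matrix of generators of the algebra `M(R̂,F̂)`:
`R̂₁ M_{\overline{1}} M_{\overline{2}} = M_{\overline{1}} M_{\overline{2}} (R̂^{FF})₁`
on `V ⊗ V`. -/
def IsGenerators {K : Type*} [Field K] {A : Type*} [Ring A] [Algebra K A] {N : ℕ}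
    (R F : M2 N K) (M : Matrix (Fin N) (Fin N) A) : Prop :=
  site 2 0 (R.map (algebraMap K A)) *
      MbarSeg 2 (F.map (algebraMap K A)) ((F⁻¹).map (algebraMap K A)) M 0 2 =
    MbarSeg 2 (F.map (algebraMap K A)) ((F⁻¹).map (algebraMap K A)) M 0 2 *
      site 2 0 ((RFF R F).map (algebraMap K A))

/-- Evaluation of a noncommutative polynomial `Y` in `v` variables, substituting
for the variable `x_j` the operator `R̂` placed at the (0-based) sites
`p+j, p+j+1` of `V^{⊗m}`.  For `p = 0` this is the paper's
`Y^{(v+1)} = Y^{(v+1)}(R̂₁,…,R̂_v)`, and a general `p` gives `Y^{(p+1,v+1)}`. -/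
def evalY {K : Type*} [Field K] {A : Type*} [Ring A] [Algebra K A] {N m v : ℕ}
    (R : M2 N A) (p : ℕ) (Y : FreeAlgebra K (Fin v)) : Op N A m :=
  FreeAlgebra.lift K (fun j : Fin v => site m (p + (j : ℕ)) R) Y

/-- `Ustack m R k l = R̂_{l → l+k-1} ⋯ R̂_{2 → k+1} R̂_{1 → k}` (1-based labels):
the product of `l` descending chains of length `k`. -/
def Ustack {A : Type*} [Ring A] {N : ℕ} (m : ℕ) (R : M2 N A) (k : ℕ) :
    ℕ → Op N A m
  | 0 => 1
  | l + 1 => chain m R l k * Ustack m R k l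

/-- The `q`-number `n_q = (qⁿ − q⁻ⁿ)/(q − q⁻¹)`. -/
def qInt {K : Type*} [Field K] (q : K) (n : ℕ) : K :=
  (q ^ n - q⁻¹ ^ n) / (q - q⁻¹)

/-- `R̂` is a Hecke R-matrix for the parameter `q`:  it is invertible, satisfies
the Yang–Baxter equation and the Hecke condition `R̂² = 1 + (q − q⁻¹)R̂`. -/
def IsHecke {K : Type*} [Field K] {N : ℕ} (q : K) (R : M2 N K) : Prop :=
  IsUnit R ∧ YB R ∧ R * R = 1 + (q - q⁻¹) • R

/-- The `q`-antisymmetrizer `A^{(k)}` built from `R̂`, placed at the (0-based)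
tensor factors `p, p+1, …, p+k-1` of `V^{⊗m}`. -/
def qasym {K : Type*} [Field K] {N : ℕ} (q : K) (R : M2 N K) (m p : ℕ) :
    ℕ → Op N K m
  | 0 => 1
  | 1 => 1
  | k + 2 =>
      (qInt q (k + 2))⁻¹ •
        (qasym q R m p (k + 1) *
          (q ^ (k + 1) • (1 : Op N K m) - qInt q (k + 1) • site m (p + k) R) *
          qasym q R m p (k + 1))

/-- The `q`-symmetrizer `S^{(k)}` built from `R̂`, placed at the (0-based)
tensor factors `p, p+1, …, p+k-1` of `V^{⊗m}`. -/
def qsym {K : Type*} [Field K] {N : ℕ} (q : K) (R : M2 N K) (m p : ℕ) :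
    ℕ → Op N K m
  | 0 => 1
  | 1 => 1
  | k + 2 =>
      (qInt q (k + 2))⁻¹ •
        (qsym q R m p (k + 1) *
          (q⁻¹ ^ (k + 1) • (1 : Op N K m) + qInt q (k + 1) • site m (p + k) R) *
          qsym q R m p (k + 1))

/-- The elementary symmetric function
`σ_k(M) = Tr_F(1,…,k)(A^{(k)} M_{\overline{1}}⋯M_{\overline{k}})` (with `σ_0 = 1`). -/
def sigmaF {K : Type*} [Field K] {A : Type*} [Ring A] [Algebra K A] {N : ℕ}
    (q : K) (R F Ψ : M2 N K) (M : Matrix (Fin N) (Fin N) A) (k : ℕ) : A :=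
  qtrAll (Dmat Ψ)
    ((qasym q R k 0 k).map (algebraMap K A) *
      MbarSeg k (F.map (algebraMap K A)) ((F⁻¹).map (algebraMap K A)) M 0 k)

/-- The complete symmetric function
`τ_k(M) = Tr_F(1,…,k)(S^{(k)} M_{\overline{1}}⋯M_{\overline{k}})` (with `τ_0 = 1`). -/
def tauF {K : Type*} [Field K] {A : Type*} [Ring A] [Algebra K A] {N : ℕ}
    (q : K) (R F Ψ : M2 N K) (M : Matrix (Fin N) (Fin N) A) (k : ℕ) : A :=
  qtrAll (Dmat Ψ)
    ((qsym q R k 0 k).map (algebraMap K A) *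
      MbarSeg k (F.map (algebraMap K A)) ((F⁻¹).map (algebraMap K A)) M 0 k)

/-- The power sums `s_k(M) = Tr_F(1,…,k)(R̂_{1→k−1} M_{\overline{1}}⋯M_{\overline{k}})`,
with `s_0 = 1`. -/
def sF {K : Type*} [Field K] {A : Type*} [Ring A] [Algebra K A] {N : ℕ}
    (R F Ψ : M2 N K) (M : Matrix (Fin N) (Fin N) A) : ℕ → A
  | 0 => 1
  | j + 1 =>
      qtrAll (Dmat Ψ)
        (chain (j + 1) (R.map (algebraMap K A)) 0 j *
          MbarSeg (j + 1) (F.map (algebraMap K A)) ((F⁻¹).map (algebraMap K A)) M 0 (j + 1))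

/-- The `(j+1)`-st quantum power of `M`,
`M^{\overline{j+1}} = Tr_F(2,…,j+1)(R̂_{1→j} M_{\overline{1}}⋯M_{\overline{j+1}})`,
as a one-site operator (so `MpowF R F Ψ M 0 = M₁ = M`). -/
def MpowF {K : Type*} [Field K] {A : Type*} [Ring A] [Algebra K A] {N : ℕ}
    (R F Ψ : M2 N K) (M : Matrix (Fin N) (Fin N) A) (j : ℕ) : Op N A 1 :=
  qtrs (Dmat Ψ) 1 j
    (chain (1 + j) (R.map (algebraMap K A)) 0 j *
      MbarSeg (1 + j) (F.map (algebraMap K A)) ((F⁻¹).map (algebraMap K A)) M 0 (j + 1))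

/-- The `(j+1)`-st wedge power of `M`,
`M^{∧(j+1)} = Tr_F(2,…,j+1)(A^{(j+1)} M_{\overline{1}}⋯M_{\overline{j+1}})`. -/
def MwedgeF {K : Type*} [Field K] {A : Type*} [Ring A] [Algebra K A] {N : ℕ}
    (q : K) (R F Ψ : M2 N K) (M : Matrix (Fin N) (Fin N) A) (j : ℕ) : Op N A 1 :=
  qtrs (Dmat Ψ) 1 j
    ((qasym q R (1 + j) 0 (j + 1)).map (algebraMap K A) *
      MbarSeg (1 + j) (F.map (algebraMap K A)) ((F⁻¹).map (algebraMap K A)) M 0 (j + 1))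

/-- The `(j+1)`-st symmetric power of `M`,
`M^{S(j+1)} = Tr_F(2,…,j+1)(S^{(j+1)} M_{\overline{1}}⋯M_{\overline{j+1}})`. -/
def MsymF {K : Type*} [Field K] {A : Type*} [Ring A] [Algebra K A] {N : ℕ}
    (q : K) (R F Ψ : M2 N K) (M : Matrix (Fin N) (Fin N) A) (j : ℕ) : Op N A 1 :=
  qtrs (Dmat Ψ) 1 j
    ((qsym q R (1 + j) 0 (j + 1)).map (algebraMap K A) *
      MbarSeg (1 + j) (F.map (algebraMap K A)) ((F⁻¹).map (algebraMap K A)) M 0 (j + 1))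

/-- `M^{\overline{0}} := q^{-n} n_q Tr_{(2,…,n)}(A^{(n)}) D^{-1}`, with `n = n0 + 1`
(an ordinary, non-quantum, trace over the factors `2,…,n`). -/
def MzeroF {K : Type*} [Field K] {N : ℕ} (q : K) (R Ψ : M2 N K) (n0 : ℕ) :
    Op N K 1 :=
  (q⁻¹ ^ (n0 + 1) * qInt q (n0 + 1)) •
    (ptrs 1 n0 (qasym q R (1 + n0) 0 (n0 + 1)) * site1 1 0 ((Dmat Ψ)⁻¹))

/-- The generators of the characteristic subalgebra: all elements
`α(Y^{(k)}) = Tr_F(1,…,k)(Y^{(k)} M_{\overline{1}}⋯M_{\overline{k}})`, `k ≥ 1`. -/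
def charSet {K : Type*} [Field K] {A : Type*} [Ring A] [Algebra K A] {N : ℕ}
    (R F Ψ : M2 N K) (M : Matrix (Fin N) (Fin N) A) : Set A :=
  { x : A | ∃ (v : ℕ) (Y : FreeAlgebra K (Fin v)),
      x = qtrAll (Dmat Ψ)
        (evalY (R.map (algebraMap K A)) 0 Y *
          MbarSeg (v + 1) (F.map (algebraMap K A)) ((F⁻¹).map (algebraMap K A)) M 0 (v + 1)) }

end

/-! ### Antisymmetrizers in a Hecke algebra -/

section Hecke

variable {K B : Type*} [Field K] [Ring B] [Algebra K B]

/-- The elements `g 0, …, g (l - 1)` satisfy the relations of the Hecke algebra. -/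
structure IsHeckeSeq (q : K) (g : ℕ → B) (l : ℕ) : Prop where
  quad : ∀ i < l, g i * g i = 1 + (q - q⁻¹) • g i
  braid : ∀ i, i + 1 < l → g i * g (i + 1) * g i = g (i + 1) * g i * g (i + 1)
  comm : ∀ i j, i + 2 ≤ j → j < l → Commute (g i) (g j)

/-- The `q`-antisymmetrizer on `k` strands built from the generators `g 0, …, g (k - 2)`. -/
noncomputable def heckeAsym (q : K) (g : ℕ → B) : ℕ → B
  | 0 => 1
  | 1 => 1
  | k + 2 =>
      (qInt q (k + 2))⁻¹ •
        (heckeAsym q g (k + 1) *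
          (q ^ (k + 1) • (1 : B) - qInt q (k + 1) • g k) * heckeAsym q g (k + 1))

theorem IsHeckeSeq.shift {q : K} {g : ℕ → B} {l : ℕ} (h : IsHeckeSeq q g l) {p l' : ℕ}
    (hp : p + l' ≤ l) : IsHeckeSeq q (fun i => g (p + i)) l' where
  quad i hi := h.quad _ (by omega)
  braid i hi := h.braid (p + i) (by omega)
  comm i j hij hj := h.comm _ _ (by omega) (by omega)

theorem IsHeckeSeq.reverse {q : K} {g : ℕ → B} {c l : ℕ} (h : IsHeckeSeq q g l) (hc : c < l) :
    IsHeckeSeq q (fun i => g (c - i)) (c + 1) where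
  quad i hi := h.quad _ (by omega)
  braid i hi := by
    have := h.braid (c - (i + 1)) (by omega)
    rw [show c - (i + 1) + 1 = c - i by omega] at this
    exact this.symm
  comm i j hij hj := (h.comm _ _ (by omega) (by omega)).symm

theorem IsHeckeSeq.neg_inv {q : K} {g : ℕ → B} {l : ℕ} (h : IsHeckeSeq q g l) :
    IsHeckeSeq (-q⁻¹) g l where
  quad i hi := by rw [h.quad i hi]; congr 2; rw [inv_neg, inv_inv]; ring
  braid := h.braid
  comm := h.comm

theorem heckeAsym_congr {q : K} {g g' : ℕ → B} {k : ℕ} (h : ∀ i, i + 1 < k → g i = g' i) :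
    heckeAsym q g k = heckeAsym q g' k := by
  match k with
  | 0 => rfl
  | 1 => rfl
  | k + 2 =>
    have ih := heckeAsym_congr (k := k + 1) (q := q) (g := g) (g' := g')
      (fun i hi => h i (by omega))
    simp only [heckeAsym, ih, h k (by omega)]

theorem SemiconjBy.heckeAsym {q : K} {g g' : ℕ → B} {k : ℕ} {z : B}
    (h : ∀ i, i + 1 < k → SemiconjBy z (g i) (g' i)) :
    SemiconjBy z (heckeAsym q g k) (CHN.heckeAsym q g' k) := by
  match k with
  | 0 => exact SemiconjBy.one_right z
  | 1 => exact SemiconjBy.one_right z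
  | k + 2 =>
    have ih := SemiconjBy.heckeAsym (k := k + 1) (q := q) (g := g) (g' := g')
      (fun i hi => h i (by omega))
    have hk := h k (by omega)
    have hm : SemiconjBy z (q ^ (k + 1) • (1 : B) - qInt q (k + 1) • g k)
        (q ^ (k + 1) • (1 : B) - qInt q (k + 1) • g' k) := by
      unfold SemiconjBy at *
      simp only [mul_sub, sub_mul, mul_smul_comm, smul_mul_assoc, hk, mul_one, one_mul]
    have := (ih.mul_right hm).mul_right ih
    unfold SemiconjBy at *
    simp only [CHN.heckeAsym, mul_smul_comm, smul_mul_assoc, this]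

theorem qInt_one {q : K} (h : qInt q 1 ≠ 0) : qInt q 1 = 1 := by
  unfold qInt at *
  simp only [pow_one] at *
  exact div_self fun h0 => h (by rw [h0, div_zero])

theorem qInt_sub_ne_zero {q : K} (h : qInt q 1 ≠ 0) : q - q⁻¹ ≠ 0 := fun h0 => h (by simp [qInt, h0])

theorem qInt_succ {q : K} (h : qInt q 1 ≠ 0) (n : ℕ) :
    q ^ n + qInt q n * q⁻¹ = qInt q (n + 1) := by
  have := qInt_sub_ne_zero h
  unfold qInt
  rw [eq_div_iff this, add_mul, mul_right_comm, div_mul_cancel₀ _ this]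
  ring

theorem qInt_add {q : K} (h : qInt q 1 ≠ 0) (a b : ℕ) :
    qInt q a * q ^ b + qInt q b * q⁻¹ ^ a = qInt q (a + b) := by
  have := qInt_sub_ne_zero h
  unfold qInt
  rw [eq_div_iff this, add_mul, mul_right_comm, div_mul_cancel₀ _ this, mul_right_comm,
    div_mul_cancel₀ _ this]
  ring

theorem qInt_neg_inv {q : K} (h : qInt q 1 ≠ 0) (n : ℕ) :
    qInt (-q⁻¹) n = (-1) ^ (n + 1) * qInt q n := by
  have := qInt_sub_ne_zero h
  unfold qInt
  have h2 : -q⁻¹ - (-q⁻¹)⁻¹ = q - q⁻¹ := by rw [inv_neg, inv_inv]; ring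
  rw [h2, inv_neg, inv_inv, neg_pow, neg_pow q]
  ring

variable {q : K} {g : ℕ → B}

theorem mul_heckeAsym_of_absorb (hqn : ∀ n : ℕ, 1 ≤ n → qInt q n ≠ 0) {z : B} {k : ℕ}
    (h : ∀ i, i + 1 < k → z * g i = -q⁻¹ • z) : z * heckeAsym q g k = z := by
  match k with
  | 0 => exact mul_one z
  | 1 => exact mul_one z
  | k + 2 =>
    have ih := mul_heckeAsym_of_absorb hqn (k := k + 1) (z := z) (fun i hi => h i (by omega))
    have e := qInt_succ (hqn 1 le_rfl) (k + 1)
    rw [heckeAsym, mul_smul_comm, ← mul_assoc, ← mul_assoc, ih, mul_sub, mul_smul_comm,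
      mul_smul_comm, h k (by omega), mul_one, smul_smul, ← sub_smul, smul_mul_assoc, ih, smul_smul,
      show q ^ (k + 1) - qInt q (k + 1) * -q⁻¹ = qInt q (k + 2) by rw [← e]; ring,
      inv_mul_cancel₀ (hqn _ (by omega)), one_smul]

theorem heckeAsym_mul_of_absorb (hqn : ∀ n : ℕ, 1 ≤ n → qInt q n ≠ 0) {z : B} {k : ℕ}
    (h : ∀ i, i + 1 < k → g i * z = -q⁻¹ • z) : heckeAsym q g k * z = z := by
  match k with
  | 0 => exact one_mul z
  | 1 => exact one_mul z
  | k + 2 =>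
    have ih := heckeAsym_mul_of_absorb hqn (k := k + 1) (z := z) (fun i hi => h i (by omega))
    have e := qInt_succ (hqn 1 le_rfl) (k + 1)
    rw [heckeAsym, smul_mul_assoc, mul_assoc, mul_assoc, ih, sub_mul, smul_mul_assoc,
      smul_mul_assoc, h k (by omega), one_mul, smul_smul, ← sub_smul, mul_smul_comm, ih, smul_smul,
      show q ^ (k + 1) - qInt q (k + 1) * -q⁻¹ = qInt q (k + 2) by rw [← e]; ring,
      inv_mul_cancel₀ (hqn _ (by omega)), one_smul]

theorem absorb_left_step {x y e f : B} {m n Q : K} (hq : q ≠ 0)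
    (hx : x * x = 1 + (q - q⁻¹) • x) (hxy : x * y * x = y * x * y) (hex : e * x = x * e)
    (hef : e * f = f) (hff : f * f = f) (hyf : y * f = -q⁻¹ • f)
    (hf : n • f = e * (Q • (1 : B) - m • y) * e) :
    x * (f * ((q * Q) • (1 : B) - n • x) * f) =
      -q⁻¹ • (f * ((q * Q) • (1 : B) - n • x) * f) := by
  have h1 : n • (f * x * f) = Q • (x * f) - m • (e * y * x * f) := by
    calc n • (f * x * f) = (n • f) * x * f := by simp only [smul_mul_assoc]
      _ = e * (Q • (1 : B) - m • y) * (e * x) * f := by rw [hf]; simp only [mul_assoc]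
      _ = e * (Q • (1 : B) - m • y) * x * (e * f) := by rw [hex]; simp only [mul_assoc]
      _ = Q • (e * x * f) - m • (e * y * x * f) := by
        rw [hef]
        simp only [mul_sub, sub_mul, mul_smul_comm, smul_mul_assoc, mul_one]
      _ = _ := by rw [hex, mul_assoc x e f, hef]
  have h2 : x * (e * y * x * f) = -q⁻¹ • (e * y * x * f) := by
    calc x * (e * y * x * f) = (x * e) * y * x * f := by simp only [mul_assoc]
      _ = e * (x * y * x) * f := by rw [← hex]; simp only [mul_assoc]
      _ = e * y * x * (y * f) := by rw [hxy]; simp only [mul_assoc]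
      _ = _ := by rw [hyf, mul_smul_comm]
  have h3 : x * (x * f) = f + (q - q⁻¹) • (x * f) := by
    rw [← mul_assoc, hx, add_mul, one_mul, smul_mul_assoc]
  have h4 : f * ((q * Q) • (1 : B) - n • x) * f =
      (q * Q) • f - (Q • (x * f) - m • (e * y * x * f)) := by
    rw [← h1]
    simp only [mul_sub, sub_mul, mul_smul_comm, smul_mul_assoc, mul_one, hff]
  rw [h4]
  simp only [mul_sub, mul_smul_comm, h2, h3]
  match_scalars <;> field_simp
  ring

theorem absorb_right_step {x y e f : B} {m n Q : K} (hq : q ≠ 0)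
    (hx : x * x = 1 + (q - q⁻¹) • x) (hxy : x * y * x = y * x * y) (hex : e * x = x * e)
    (hfe : f * e = f) (hff : f * f = f) (hfy : f * y = -q⁻¹ • f)
    (hf : n • f = e * (Q • (1 : B) - m • y) * e) :
    f * ((q * Q) • (1 : B) - n • x) * f * x =
      -q⁻¹ • (f * ((q * Q) • (1 : B) - n • x) * f) := by
  have h1 : n • (f * x * f) = Q • (f * x) - m • (f * x * y * e) := by
    calc n • (f * x * f) = f * x * (n • f) := by simp only [mul_smul_comm]
      _ = f * (x * e) * (Q • (1 : B) - m • y) * e := by rw [hf]; simp only [mul_assoc]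
      _ = (f * e) * x * (Q • (1 : B) - m • y) * e := by rw [← hex]; simp only [mul_assoc]
      _ = Q • (f * (x * e)) - m • (f * x * y * e) := by
        rw [hfe]
        simp only [mul_sub, sub_mul, mul_smul_comm, smul_mul_assoc, mul_one, mul_assoc]
      _ = _ := by rw [← hex, ← mul_assoc f e x, hfe]
  have h2 : f * x * y * e * x = -q⁻¹ • (f * x * y * e) := by
    calc f * x * y * e * x = f * (x * y * x) * e := by
          rw [mul_assoc _ e x, hex]; simp only [mul_assoc]
      _ = (f * y) * x * y * e := by rw [hxy]; simp only [mul_assoc]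
      _ = _ := by rw [hfy]; simp only [smul_mul_assoc]
  have h3 : f * x * x = f + (q - q⁻¹) • (f * x) := by
    rw [mul_assoc, hx, mul_add, mul_one, mul_smul_comm]
  have h4 : f * ((q * Q) • (1 : B) - n • x) * f =
      (q * Q) • f - (Q • (f * x) - m • (f * x * y * e)) := by
    rw [← h1]
    simp only [mul_sub, sub_mul, mul_smul_comm, smul_mul_assoc, mul_one, hff]
  rw [h4]
  simp only [sub_mul, smul_mul_assoc, h2, h3]
  match_scalars <;> field_simp
  ring

/-- The antisymmetrizer absorbs each of its generators, on either side. -/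
theorem IsHeckeSeq.absorb (hq : q ≠ 0) (hqn : ∀ n : ℕ, 1 ≤ n → qInt q n ≠ 0) {l : ℕ}
    (h : IsHeckeSeq q g l) : ∀ {k : ℕ}, k ≤ l + 1 → ∀ i, i + 1 < k →
      g i * heckeAsym q g k = -q⁻¹ • heckeAsym q g k ∧
      heckeAsym q g k * g i = -q⁻¹ • heckeAsym q g k
  | 0, _, i, hi => by omega
  | 1, _, i, hi => by omega
  | 2, hk, i, hi => by
    obtain rfl : i = 0 := by omega
    have hx := h.quad 0 (by omega)
    have h1 := qInt_one (hqn 1 le_rfl)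
    constructor
    · simp only [heckeAsym, zero_add, h1, mul_one, one_mul, one_smul, mul_smul_comm, mul_sub, hx,
        pow_one]
      match_scalars <;> field_simp
      ring
    · simp only [heckeAsym, zero_add, h1, mul_one, one_mul, one_smul, smul_mul_assoc, sub_mul, hx,
        pow_one]
      match_scalars <;> field_simp
      ring
  | k + 3, hk, i, hi => by
    have ih := h.absorb hq hqn (k := k + 2) (by omega)
    have ih' := h.absorb hq hqn (k := k + 1) (by omega)
    rcases Nat.lt_or_ge (i + 1) (k + 2) with hi' | hi'
    · rw [heckeAsym, mul_smul_comm, smul_mul_assoc, ← mul_assoc, ← mul_assoc, (ih i hi').1,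
        mul_assoc _ _ (g i), (ih i hi').2]
      simp only [smul_mul_assoc, mul_smul_comm, smul_comm (-q⁻¹), and_self]
    · obtain rfl : i = k + 1 := by omega
      have hf : qInt q (k + 2) • heckeAsym q g (k + 2) = heckeAsym q g (k + 1) *
          (q ^ (k + 1) • (1 : B) - qInt q (k + 1) • g k) * heckeAsym q g (k + 1) := by
        rw [heckeAsym, smul_smul, mul_inv_cancel₀ (hqn _ (by omega)), one_smul]
      have hx := h.quad (k + 1) (by omega)
      have hxy := (h.braid k (by omega)).symm
      have hex : heckeAsym q g (k + 1) * g (k + 1) = g (k + 1) * heckeAsym q g (k + 1) :=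
        (SemiconjBy.heckeAsym fun i hi => (h.comm i (k + 1) (by omega) (by omega)).symm).symm
      have hff : heckeAsym q g (k + 2) * heckeAsym q g (k + 2) = heckeAsym q g (k + 2) :=
        mul_heckeAsym_of_absorb hqn fun i hi => (ih i hi).2
      have hef : heckeAsym q g (k + 1) * heckeAsym q g (k + 2) = heckeAsym q g (k + 2) :=
        heckeAsym_mul_of_absorb hqn fun i hi => (ih i (by omega)).1
      have hfe : heckeAsym q g (k + 2) * heckeAsym q g (k + 1) = heckeAsym q g (k + 2) :=
        mul_heckeAsym_of_absorb hqn fun i hi => (ih i (by omega)).2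
      have hl := absorb_left_step hq hx hxy hex hef hff (ih k (by omega)).1 hf
      have hr := absorb_right_step hq hx hxy hex hfe hff (ih k (by omega)).2 hf
      rw [← pow_succ'] at hl hr
      rw [heckeAsym, mul_smul_comm, smul_mul_assoc, hl, hr, smul_comm]
      exact ⟨rfl, rfl⟩

theorem IsHeckeSeq.idempotent (hq : q ≠ 0) (hqn : ∀ n : ℕ, 1 ≤ n → qInt q n ≠ 0) {l : ℕ}
    (h : IsHeckeSeq q g l) {k : ℕ} (hk : k ≤ l + 1) :
    heckeAsym q g k * heckeAsym q g k = heckeAsym q g k :=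
  mul_heckeAsym_of_absorb hqn fun i hi => (h.absorb hq hqn hk i hi).2

theorem IsHeckeSeq.heckeAsym_reverse (hq : q ≠ 0) (hqn : ∀ n : ℕ, 1 ≤ n → qInt q n ≠ 0) {l : ℕ}
    (h : IsHeckeSeq q g l) {k : ℕ} (hk : k + 1 ≤ l) :
    heckeAsym q (fun i => g (k - i)) (k + 2) = heckeAsym q g (k + 2) := by
  have h' : IsHeckeSeq q (fun i => g (k - i)) (k + 1) := h.reverse (by omega)
  have e1 : heckeAsym q g (k + 2) * heckeAsym q (fun i => g (k - i)) (k + 2) =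
      heckeAsym q g (k + 2) :=
    mul_heckeAsym_of_absorb hqn fun i hi => (h.absorb hq hqn (by omega) (k - i) (by omega)).2
  rw [← e1]
  refine (heckeAsym_mul_of_absorb hqn fun i hi => ?_).symm
  have := (h'.absorb hq hqn le_rfl (k - i) (by omega)).1
  rwa [show k - (k - i) = i by omega] at this

/-- The recursion for antisymmetrizers that adds a strand on the left. -/
theorem IsHeckeSeq.heckeAsym_left (hq : q ≠ 0) (hqn : ∀ n : ℕ, 1 ≤ n → qInt q n ≠ 0) {l : ℕ}
    (h : IsHeckeSeq q g l) {k : ℕ} (hk : k + 1 ≤ l) :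
    heckeAsym q g (k + 2) = (qInt q (k + 2))⁻¹ •
      (heckeAsym q (fun i => g (i + 1)) (k + 1) *
        (q ^ (k + 1) • (1 : B) - qInt q (k + 1) • g 0) *
          heckeAsym q (fun i => g (i + 1)) (k + 1)) := by
  have e : heckeAsym q (fun i => g (k - i)) (k + 1) = heckeAsym q (fun i => g (i + 1)) (k + 1) := by
    cases k with
    | zero => rfl
    | succ k =>
      have h1 : IsHeckeSeq q (fun i => g (i + 1)) (l - 1) := by
        simpa only [add_comm] using h.shift (p := 1) (l' := l - 1) (by omega)
      rw [← h1.heckeAsym_reverse hq hqn (by omega)]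
      refine heckeAsym_congr fun i hi => ?_
      rw [show k + 1 - i = k - i + 1 by omega]
  rw [← h.heckeAsym_reverse hq hqn hk, heckeAsym, e, Nat.sub_self]

end Hecke

section Trace

variable {K B W : Type*} [Field K] [Ring B] [Algebra K B] [AddCommGroup W] [Module K W]
variable {q : K} {g : ℕ → B}

theorem heckeAsym_neg_inv (h1 : qInt q 1 ≠ 0) (k : ℕ) :
    heckeAsym (-q⁻¹) g (k + 2) = (qInt q (k + 2))⁻¹ •
      (heckeAsym (-q⁻¹) g (k + 1) * (q⁻¹ ^ (k + 1) • (1 : B) + qInt q (k + 1) • g k) *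
        heckeAsym (-q⁻¹) g (k + 1)) := by
  have e : (-q⁻¹) ^ (k + 1) • (1 : B) - qInt (-q⁻¹) (k + 1) • g k =
      (-1 : K) ^ (k + 1) • (q⁻¹ ^ (k + 1) • (1 : B) + qInt q (k + 1) • g k) := by
    rw [qInt_neg_inv h1, neg_pow q⁻¹, pow_succ _ (k + 1)]
    module
  rw [heckeAsym, e, mul_smul_comm, smul_mul_assoc, smul_smul, qInt_neg_inv h1]
  congr 1
  rw [show k + 2 + 1 = k + 1 + 2 by rfl, pow_add _ _ 2, neg_one_sq, mul_one, mul_inv, mul_right_comm,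
    inv_mul_cancel₀ (pow_ne_zero _ (neg_ne_zero.2 one_ne_zero)), one_mul]

theorem trace_heckeAsym_comm (α : B →ₗ[K] W) {k : ℕ}
    (hα : ∀ i, i + 1 < k → ∀ X, α (g i * X) = α (X * g i)) (X : B) :
    α (heckeAsym q g k * X) = α (X * heckeAsym q g k) := by
  induction k using Nat.strong_induction_on generalizing X with
  | _ k ih =>
    match k, ih with
    | 0, _ => simp [heckeAsym]
    | 1, _ => simp [heckeAsym]
    | k + 2, ih =>
      have ih' := ih (k + 1) (by omega) fun i hi => hα i (by omega)
      have hx := hα k (by omega)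
      have hm (Y : B) : α ((q ^ (k + 1) • (1 : B) - qInt q (k + 1) • g k) * Y) =
          α (Y * (q ^ (k + 1) • (1 : B) - qInt q (k + 1) • g k)) := by
        simp only [sub_mul, mul_sub, smul_mul_assoc, mul_smul_comm, one_mul, mul_one, map_sub,
          map_smul, hx]
      rw [heckeAsym, smul_mul_assoc, mul_smul_comm, map_smul, map_smul, mul_assoc, mul_assoc, ih',
        mul_assoc, hm, mul_assoc, mul_assoc, ih', mul_assoc, mul_assoc]

theorem sum_alternating_add (G : ℕ → W) (m : ℕ) :
    ∑ i ∈ Finset.range m, (-1 : K) ^ i • (G (i + 1) + G i) = G 0 - (-1 : K) ^ m • G m := by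
  induction m with
  | zero => simp
  | succ m ih =>
    rw [Finset.sum_range_succ, ih, pow_succ]
    module

/-- Adjacent hook traces add up to the trace of a product of a symmetrizer and an
antisymmetrizer on disjoint strands. -/
theorem IsHeckeSeq.trace_hook (hq : q ≠ 0) (hqn : ∀ n : ℕ, 1 ≤ n → qInt q n ≠ 0) {a b : ℕ}
    (h : IsHeckeSeq q g (a + b + 1)) (α : B →ₗ[K] W)
    (hα : ∀ i, i < a + b + 1 → ∀ X, α (g i * X) = α (X * g i)) :
    qInt q (a + b + 2) • α (heckeAsym (-q⁻¹) g (a + 1) *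
        heckeAsym q (fun t => g (a + 1 + t)) (b + 1)) =
      (qInt q (a + 1) * qInt q (b + 2)) • α (heckeAsym (-q⁻¹) g (a + 1) *
        heckeAsym q (fun t => g (a + t)) (b + 2)) +
      (qInt q (a + 2) * qInt q (b + 1)) • α (heckeAsym (-q⁻¹) g (a + 2) *
        heckeAsym q (fun t => g (a + 1 + t)) (b + 1)) := by
  have h1 := hqn 1 le_rfl
  have hA := (h.shift (p := a) (l' := b + 1) (by omega)).heckeAsym_left hq hqn le_rfl
  have e : (fun i => g (a + (i + 1))) = fun i => g (a + 1 + i) := by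
    funext i; congr 1; omega
  rw [e, add_zero] at hA
  have hqn' : ∀ n : ℕ, 1 ≤ n → qInt (-q⁻¹) n ≠ 0 := fun n hn => by
    rw [qInt_neg_inv h1]
    exact mul_ne_zero (pow_ne_zero _ (neg_ne_zero.2 one_ne_zero)) (hqn n hn)
  have hSS := (h.neg_inv).idempotent (neg_ne_zero.2 (inv_ne_zero hq)) hqn' (k := a + 1) (by omega)
  have hAA := (h.shift (p := a + 1) (l' := b) (by omega)).idempotent hq hqn (k := b + 1) le_rfl
  have hSA : heckeAsym (-q⁻¹) g (a + 1) * heckeAsym q (fun t => g (a + 1 + t)) (b + 1) =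
      heckeAsym q (fun t => g (a + 1 + t)) (b + 1) * heckeAsym (-q⁻¹) g (a + 1) := by
    refine SemiconjBy.heckeAsym fun i hi => ?_
    exact (SemiconjBy.heckeAsym fun j hj => (h.comm j _ (by omega) (by omega)).symm).symm
  have hS := trace_heckeAsym_comm (q := -q⁻¹) α (k := a + 1) fun i hi => hα i (by omega)
  have hA' := trace_heckeAsym_comm (q := q) (g := fun t => g (a + 1 + t)) α (k := b + 1)
    fun i hi => hα _ (by omega)
  have hx := hα a (by omega)
  rw [hA, heckeAsym_neg_inv h1]
  set S := heckeAsym (-q⁻¹) g (a + 1)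
  set A := heckeAsym q (fun t => g (a + 1 + t)) (b + 1)
  have t1 : α (S * (A * (q ^ (b + 1) • (1 : B) - qInt q (b + 1) • g a) * A)) =
      q ^ (b + 1) • α (S * A) - qInt q (b + 1) • α (g a * (S * A)) := by
    rw [← mul_assoc, ← hA', hx, ← mul_assoc, ← mul_assoc, ← hSA, mul_assoc S A A,
      hAA]
    simp only [mul_sub, mul_smul_comm, mul_one, map_sub, map_smul]
  have t2 : α (S * (q⁻¹ ^ (a + 1) • (1 : B) + qInt q (a + 1) • g a) * S * A) =
      q⁻¹ ^ (a + 1) • α (S * A) + qInt q (a + 1) • α (g a * (S * A)) := by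
    rw [mul_assoc, mul_assoc, hS, mul_assoc, mul_assoc, ← hSA, ← mul_assoc S S A, hSS]
    simp only [add_mul, smul_mul_assoc, one_mul, map_add, map_smul]
  rw [mul_smul_comm, smul_mul_assoc, map_smul, map_smul, t1, t2, smul_smul, smul_smul,
    mul_assoc, mul_inv_cancel₀ (hqn _ (by omega)), mul_right_comm,
    mul_inv_cancel₀ (hqn _ (by omega)), show a + b + 2 = (a + 1) + (b + 1) by omega,
    ← qInt_add h1 (a + 1) (b + 1)]
  module

/-- Wronski relations for a trace on a Hecke algebra. -/
theorem IsHeckeSeq.trace_wronski (hq : q ≠ 0) (hqn : ∀ n : ℕ, 1 ≤ n → qInt q n ≠ 0) {l : ℕ}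
    (h : IsHeckeSeq q g l) (α : B →ₗ[K] W)
    (hα : ∀ i, i < l → ∀ X, α (g i * X) = α (X * g i)) :
    ∑ i ∈ Finset.range (l + 2), (-1 : K) ^ i • α (heckeAsym (-q⁻¹) g (l + 1 - i) *
      heckeAsym q (fun t => g (l + 1 - i + t)) i) = 0 := by
  have q0 : qInt q 0 = 0 := by simp [qInt]
  have q1 := qInt_one (hqn 1 le_rfl)
  set G : ℕ → W := fun i => (qInt q (l + 2 - i) * qInt q i) •
    α (heckeAsym (-q⁻¹) g (l + 2 - i) * heckeAsym q (fun t => g (l + 1 - i + t)) i) with hG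
  have key : ∀ i ∈ Finset.range (l + 2), qInt q (l + 1) • ((-1 : K) ^ i •
      α (heckeAsym (-q⁻¹) g (l + 1 - i) * heckeAsym q (fun t => g (l + 1 - i + t)) i)) =
      (-1 : K) ^ i • (G (i + 1) + G i) := by
    intro i hi
    rw [Finset.mem_range] at hi
    rw [smul_comm]
    congr 1
    match i, hi with
    | 0, _ => simp [hG, q0, q1, heckeAsym]
    | b + 1, hi =>
      rcases eq_or_ne b l with rfl | hb
      · simp [hG, q0, q1, heckeAsym, show b + 2 - (b + 1) = 1 by omega]
      · obtain ⟨a, rfl⟩ : ∃ a, l = a + b + 1 := ⟨l - b - 1, by omega⟩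
        simp only [hG, show a + b + 1 + 1 - (b + 1) = a + 1 by omega,
          show a + b + 1 + 1 - (b + 1 + 1) = a by omega,
          show a + b + 1 + 2 - (b + 1 + 1) = a + 1 by omega,
          show a + b + 1 + 2 - (b + 1) = a + 2 by omega]
        exact h.trace_hook hq hqn α hα
  have hs := Finset.sum_congr rfl key
  rw [← Finset.smul_sum, sum_alternating_add] at hs
  simp only [hG, q0, mul_zero, zero_mul, zero_smul, smul_zero, sub_zero, Nat.sub_self] at hs
  exact (smul_eq_zero.1 hs).resolve_left (hqn _ (by omega))

end Trace

/-! ### Braided copies of a matrix -/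

section Braid

variable {B : Type*} [Ring B]

/-- The product `M i * M (i + 1) * ⋯ * M (i + l - 1)`. -/
def ascProd (M : ℕ → B) (i : ℕ) : ℕ → B
  | 0 => 1
  | l + 1 => ascProd M i l * M (i + l)

/-- The product `M (i + l - 1) * ⋯ * M (i + 1) * M i`. -/
def descProd (M : ℕ → B) (i : ℕ) : ℕ → B
  | 0 => 1
  | l + 1 => M (i + l) * descProd M i l

theorem ascProd_commute {M : ℕ → B} {z : B} {i l : ℕ} (h : ∀ j < l, Commute (M (i + j)) z) :
    Commute (ascProd M i l) z := by
  induction l with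
  | zero => exact Commute.one_left z
  | succ l ih => exact (ih fun j hj => h j (by omega)).mul_left (h l (by omega))

theorem descProd_commute {M : ℕ → B} {z : B} {i l : ℕ} (h : ∀ j < l, Commute (M (i + j)) z) :
    Commute (descProd M i l) z := by
  induction l with
  | zero => exact Commute.one_left z
  | succ l ih => exact (h l (by omega)).mul_left (ih fun j hj => h j (by omega))

theorem SemiconjBy.ascProd {M : ℕ → B} {z : B} {i l : ℕ}
    (h : ∀ j < l, SemiconjBy z (M (i + j)) (M (i + 1 + j))) :
    SemiconjBy z (ascProd M i l) (CHN.ascProd M (i + 1) l) := by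
  induction l with
  | zero => exact SemiconjBy.one_right z
  | succ l ih => exact (ih fun j hj => h j (by omega)).mul_right (h l (by omega))

theorem ascProd_add (M : ℕ → B) (i a b : ℕ) :
    ascProd M i (a + b) = ascProd M i a * ascProd M (i + a) b := by
  induction b with
  | zero => exact (mul_one _).symm
  | succ b ih => rw [← add_assoc, ascProd, ih, ascProd, mul_assoc, add_assoc]

theorem ascProd_mul_descProd {F G : ℕ → B} {i l : ℕ} (h : ∀ j < l, F (i + j) * G (i + j) = 1) :
    ascProd F i l * descProd G i l = 1 := by
  induction l with
  | zero => exact mul_one _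
  | succ l ih =>
    rw [ascProd, descProd, mul_assoc, ← mul_assoc (F _), h l (by omega), one_mul,
      ih fun j hj => h j (by omega)]

theorem semiconjBy_inverse {F G x y : B} (hFG : F * G = 1) (hGF : G * F = 1)
    (h : SemiconjBy F x y) : SemiconjBy G y x := by
  have : G * (F * x) * G = G * (y * F) * G := by rw [h.eq]
  rw [← mul_assoc G, hGF, one_mul, ← mul_assoc, mul_assoc _ F, hFG, mul_one] at this
  exact this.symm

theorem commute_of_mul_eq_one {F G x : B} (hFG : F * G = 1) (hGF : G * F = 1)
    (h : Commute F x) : Commute G x :=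
  semiconjBy_inverse hFG hGF h

theorem semiconjBy_of_mul_eq_one {F G F' G' z : B} (hFG : F * G = 1) (hGF : G' * F' = 1)
    (h : SemiconjBy z F F') : SemiconjBy z G G' := by
  have : G' * (z * F) * G = G' * (F' * z) * G := by rw [h.eq]
  rw [← mul_assoc G' F', hGF, one_mul, mul_assoc, mul_assoc z, hFG, mul_one] at this
  exact this.symm

/-- A family of two-site operators `X` compatible with the braiding `F` and local with respect to
the copies `M`. -/
structure IsCompatSeq (n : ℕ) (F M X : ℕ → B) : Prop where
  far : ∀ i j, i + 2 ≤ j ∨ j + 2 ≤ i → i + 1 < n → j + 1 < n → Commute (F i) (X j)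
  up : ∀ i, i + 2 < n → F i * F (i + 1) * X i = X (i + 1) * F i * F (i + 1)
  down : ∀ i, i + 2 < n → X i * F (i + 1) * F i = F (i + 1) * F i * X (i + 1)
  commute_copy : ∀ k j, k < j → j + 1 < n → Commute (M k) (X j)

theorem IsCompatSeq.semiconj {n : ℕ} {F M X : ℕ → B} (hX : IsCompatSeq n F M X) {i : ℕ}
    (hi : i + 2 < n) : SemiconjBy (F i * F (i + 1)) (X i) (X (i + 1)) := by
  rw [SemiconjBy, hX.up i hi, mul_assoc]

/-- The braid-theoretic relations between a braiding `F` with inverse `G`, a Hecke family `R` and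
the copies `M` of a matrix of generators. -/
structure IsBraidData (n : ℕ) (F G R M : ℕ → B) : Prop where
  FG : ∀ i, i + 1 < n → F i * G i = 1
  GF : ∀ i, i + 1 < n → G i * F i = 1
  F_compat : IsCompatSeq n F M F
  R_compat : IsCompatSeq n F M R
  copy_succ : ∀ k, k + 1 < n → M (k + 1) = F k * M k * G k
  generators : 1 < n → R 0 * (M 0 * M 1) = M 0 * M 1 * (F 0 * F 0 * R 0 * G 0 * G 0)

namespace IsBraidData

variable {n : ℕ} {F G R M : ℕ → B} (h : IsBraidData n F G R M)
include h

theorem commute_of_add_two_le {X : ℕ → B} (hX : IsCompatSeq n F M X) {j k : ℕ} (hjk : j + 2 ≤ k)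
    (hk : k < n) : Commute (M k) (X j) := by
  obtain ⟨t, rfl⟩ := Nat.exists_eq_add_of_le hjk
  induction t with
  | zero =>
    have e : M (j + 2 + 0) = F (j + 1) * F j * M j * (G j * G (j + 1)) := by
      rw [add_zero, h.copy_succ _ hk, h.copy_succ _ (by omega)]
      simp only [mul_assoc]
    have hF : F (j + 1) * F j * (G j * G (j + 1)) = 1 := by
      rw [mul_assoc, ← mul_assoc (F j), h.FG j (by omega), one_mul, h.FG _ (by omega)]
    have hG : G j * G (j + 1) * (F (j + 1) * F j) = 1 := by
      rw [mul_assoc, ← mul_assoc (G (j + 1)), h.GF (j + 1) (by omega), one_mul, h.GF j (by omega)]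
    have e1 : SemiconjBy (F (j + 1) * F j) (X (j + 1)) (X j) := by
      rw [SemiconjBy, ← hX.down j (by omega), mul_assoc]
    have e2 := semiconjBy_inverse hF hG e1
    rw [e]
    exact (e1.mul_left (hX.commute_copy j (j + 1) (by omega) (by omega))).mul_left e2
  | succ t ih =>
    have hF : Commute (F (j + 2 + t)) (X j) := hX.far _ _ (by omega) (by omega) (by omega)
    have hG := commute_of_mul_eq_one (h.FG _ (by omega)) (h.GF _ (by omega)) hF
    rw [← add_assoc, h.copy_succ (j + 2 + t) (by omega)]
    exact (hF.mul_left (ih (by omega) (by omega))).mul_left hG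

theorem semiconj_copy {i : ℕ} (hi : i + 1 < n) : SemiconjBy (F i) (M i) (M (i + 1)) := by
  rw [SemiconjBy, h.copy_succ i hi, mul_assoc, h.GF i hi, mul_one]

theorem generators_all {i : ℕ} (hi : i + 1 < n) :
    R i * (M i * M (i + 1)) = M i * M (i + 1) * (F i * F i * R i * G i * G i) := by
  induction i with
  | zero => exact h.generators hi
  | succ i ih =>
    have hC : F i * F (i + 1) * (G (i + 1) * G i) = 1 := by
      rw [mul_assoc, ← mul_assoc (F (i + 1)), h.FG (i + 1) (by omega), one_mul, h.FG i (by omega)]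
    have hFF := h.F_compat.semiconj hi
    have hRR := h.R_compat.semiconj hi
    have hGG : SemiconjBy (F i * F (i + 1)) (G i) (G (i + 1)) :=
      semiconjBy_of_mul_eq_one (h.FG i (by omega)) (h.GF (i + 1) (by omega)) hFF
    have hM : SemiconjBy (F i * F (i + 1)) (M i) (M (i + 1)) :=
      (h.semiconj_copy (by omega)).mul_left
        (h.F_compat.commute_copy i (i + 1) (by omega) (by omega)).symm
    have hM' : SemiconjBy (F i * F (i + 1)) (M (i + 1)) (M (i + 1 + 1)) :=
      SemiconjBy.mul_left (h.commute_of_add_two_le h.F_compat (by omega) (by omega)).symm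
        (h.semiconj_copy (by omega))
    have hMM := hM.mul_right hM'
    have e1 := (hRR.mul_right hMM).eq
    have e2 := (hMM.mul_right ((((hFF.mul_right hFF).mul_right hRR).mul_right hGG).mul_right hGG)).eq
    rw [ih (by omega), e2] at e1
    have := congrArg (· * (G (i + 1) * G i)) e1
    simp only [mul_assoc _ (F i * F (i + 1)), hC, mul_one] at this
    simpa only [mul_assoc] using this.symm

theorem generators_ascProd {i k : ℕ} (hi : i + 1 < k) (hk : k ≤ n) :
    R i * ascProd M 0 k = ascProd M 0 k * (F i * F i * R i * G i * G i) := by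
  obtain ⟨t, rfl⟩ := Nat.exists_eq_add_of_lt hi
  rw [show i + 1 + t + 1 = i + 2 + t by omega] at *
  induction t with
  | zero =>
    have hc : Commute (ascProd M 0 i) (R i) :=
      ascProd_commute fun j hj => h.R_compat.commute_copy _ _ (by omega) (by omega)
    change R i * (ascProd M 0 i * M (0 + i) * M (0 + (i + 1))) =
      ascProd M 0 i * M (0 + i) * M (0 + (i + 1)) * _
    rw [zero_add, zero_add, mul_assoc (ascProd M 0 i), ← mul_assoc, ← hc.eq, mul_assoc,
      h.generators_all (by omega), ← mul_assoc]
  | succ t ih =>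
    have hR := h.commute_of_add_two_le h.R_compat (j := i) (k := 0 + (i + 2 + t)) (by omega) (by omega)
    have hF := h.commute_of_add_two_le h.F_compat (j := i) (k := 0 + (i + 2 + t)) (by omega) (by omega)
    have hG := (commute_of_mul_eq_one (h.FG i (by omega)) (h.GF i (by omega)) hF.symm).symm
    have hc := (((hF.mul_right hF).mul_right hR).mul_right hG).mul_right hG
    rw [← add_assoc, ascProd, ← mul_assoc, ih (by omega) (by omega), mul_assoc, ← hc.eq,
      ← mul_assoc]

omit h in
theorem semiconj_chain {X : ℕ → B} (hX : IsCompatSeq n F M X) {p b i : ℕ} (hb : p + b < n)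
    (hi : i + 1 < b) : SemiconjBy (ascProd F p b) (X (p + i)) (X (p + 1 + i)) := by
  obtain ⟨t, rfl⟩ := Nat.exists_eq_add_of_lt hi
  rw [show i + 1 + t + 1 = i + 2 + t by omega] at *
  induction t with
  | zero =>
    have hc : Commute (ascProd F p i) (X (p + i + 1)) :=
      ascProd_commute fun j hj => hX.far _ _ (by omega) (by omega) (by omega)
    change SemiconjBy (ascProd F p i * F (p + i) * F (p + (i + 1))) _ _
    rw [mul_assoc, show p + 1 + i = p + i + 1 by omega]
    exact SemiconjBy.mul_left hc (hX.semiconj (by omega))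
  | succ t ih =>
    have e : ascProd F p (i + 2 + (t + 1)) = ascProd F p (i + 2 + t) * F (p + (i + 2 + t)) := rfl
    rw [e]
    exact (ih (by omega) (by omega)).mul_left (hX.far _ _ (by omega) (by omega) (by omega))

theorem semiconj_chain_copy {p b i : ℕ} (hb : p + b < n) (hi : i < b) :
    SemiconjBy (ascProd F p b) (M (p + i)) (M (p + 1 + i)) := by
  obtain ⟨t, rfl⟩ := Nat.exists_eq_add_of_lt hi
  rw [show i + t + 1 = i + 1 + t by omega] at *
  induction t with
  | zero =>
    have hc : Commute (ascProd F p i) (M (p + i + 1)) := ascProd_commute fun j hj =>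
      (h.commute_of_add_two_le h.F_compat (by omega) (by omega)).symm
    rw [show p + 1 + i = p + i + 1 by omega]
    exact SemiconjBy.mul_left hc (h.semiconj_copy (by omega))
  | succ t ih =>
    have e : ascProd F p (i + 1 + (t + 1)) = ascProd F p (i + 1 + t) * F (p + (i + 1 + t)) := rfl
    rw [e]
    exact (ih (by omega) (by omega)).mul_left
      (h.F_compat.commute_copy _ _ (by omega) (by omega)).symm

end IsBraidData

end Braid

/-! ### Operators on tensor powers -/

section Local

open Function

variable (K : Type*) [Field K] {A : Type*} [Ring A] [Algebra K A] {V : Type*} [Fintype V]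
  [DecidableEq V] {ι κ : Type*} [Fintype ι] [DecidableEq ι] [Fintype κ] [DecidableEq κ]

/-- The matrix unit `e_{xy}` acting on the tensor factor `j`. -/
def unitAt (A : Type*) [Ring A] (j : κ) (x y : V) : Matrix (κ → V) (κ → V) A :=
  fun a b => if a j = x ∧ update a j y = b then 1 else 0

theorem unitAt_mul_apply (j : κ) (x y : V) (X : Matrix (κ → V) (κ → V) A) (a b : κ → V) :
    (unitAt A j x y * X) a b = if a j = x then X (update a j y) b else 0 := by
  simp [Matrix.mul_apply, unitAt, ite_and]

theorem mul_unitAt_apply (j : κ) (x y : V) (X : Matrix (κ → V) (κ → V) A) (a b : κ → V) :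
    (X * unitAt A j x y) a b = if b j = y then X a (update b j x) else 0 := by
  have e (c : κ → V) : (c j = x ∧ update c j y = b) ↔ (b j = y ∧ c = update b j x) := by
    constructor
    · rintro ⟨rfl, rfl⟩; simp
    · rintro ⟨rfl, rfl⟩; simp
  simp [Matrix.mul_apply, unitAt, e, ite_and]

theorem unitAt_mul_unitAt (j : κ) (x y z w : V) :
    unitAt A j x y * unitAt A j z w = if y = z then unitAt A j x w else 0 := by
  ext a b
  rw [unitAt_mul_apply]
  by_cases hyz : y = z <;> by_cases hax : a j = x <;> simp [unitAt, hyz, hax]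

theorem unitAt_commute {i j : κ} (hij : i ≠ j) (x y z w : V) :
    Commute (unitAt A i x y) (unitAt A j z w) := by
  ext a b
  rw [unitAt_mul_apply, unitAt_mul_apply]
  simp only [unitAt, update_of_ne hij, update_of_ne hij.symm, update_comm hij]
  by_cases hax : a i = x <;> by_cases haz : a j = z <;> simp [hax, haz]

theorem sum_unitAt (j : κ) : ∑ x : V, unitAt A j x x = 1 := by
  ext a b
  rw [Matrix.sum_apply, Matrix.one_apply]
  simp [unitAt, ite_and]

/-- The operator `X` acts as the identity on the tensor factor `j`. -/
def IsOff (j : κ) (X : Matrix (κ → V) (κ → V) A) : Prop :=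
  ∀ x y, Commute X (unitAt A j x y)

theorem IsOff.mul {j : κ} {X Y : Matrix (κ → V) (κ → V) A} (hX : IsOff j X) (hY : IsOff j Y) :
    IsOff j (X * Y) := fun x y => (hX x y).mul_left (hY x y)

theorem IsOff.one (j : κ) : IsOff j (1 : Matrix (κ → V) (κ → V) A) := fun _ _ => Commute.one_left _

theorem isOff_unitAt {i j : κ} (hij : i ≠ j) (x y : V) : IsOff j (unitAt A i x y) :=
  fun z w => unitAt_commute hij x y z w

/-- The component of an operator with index `(x, y)` in the tensor factor `j`. -/
def compAt (j : κ) (x y : V) : Matrix (κ → V) (κ → V) A →ₗ[K] Matrix (κ → V) (κ → V) A :=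
  ∑ s, LinearMap.mulLeft K (unitAt A j s x) ∘ₗ LinearMap.mulRight K (unitAt A j y s)

theorem compAt_def (j : κ) (x y : V) (X : Matrix (κ → V) (κ → V) A) :
    compAt K j x y X = ∑ s, unitAt A j s x * (X * unitAt A j y s) := by
  simp [compAt, LinearMap.sum_apply]

theorem isOff_compAt (j : κ) (x y : V) (X : Matrix (κ → V) (κ → V) A) :
    IsOff j (compAt K j x y X) := fun z w => by
  rw [Commute, SemiconjBy, compAt_def, Finset.sum_mul, Finset.mul_sum]
  simp only [← mul_assoc, unitAt_mul_unitAt]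
  simp only [mul_assoc, unitAt_mul_unitAt]
  simp

theorem sum_unitAt_mul_compAt (j : κ) (X : Matrix (κ → V) (κ → V) A) :
    ∑ x, ∑ y, unitAt A j x y * compAt K j x y X = X := by
  simp only [compAt_def, Finset.mul_sum, ← mul_assoc, unitAt_mul_unitAt]
  simp only [ite_mul, zero_mul, Finset.sum_ite_eq, Finset.mem_univ, if_true]
  simp only [mul_assoc, ← Finset.mul_sum, sum_unitAt, mul_one]
  rw [← Finset.sum_mul, sum_unitAt, one_mul]

theorem IsOff.compAt {i j : κ} (hij : i ≠ j) {X : Matrix (κ → V) (κ → V) A} (hX : IsOff i X)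
    (x y : V) : IsOff i (compAt K j x y X) := fun z w => by
  rw [compAt_def]
  exact Commute.sum_left _ _ _ fun s _ => (isOff_unitAt hij.symm s x).mul
    (hX.mul (isOff_unitAt hij.symm y s)) z w

variable {K}

theorem IsOff.compAt_mul {j : κ} {X : Matrix (κ → V) (κ → V) A} (hX : IsOff j X) (x y : V)
    (Y : Matrix (κ → V) (κ → V) A) : CHN.compAt K j x y (X * Y) = X * CHN.compAt K j x y Y := by
  simp only [compAt_def, Finset.mul_sum]
  simp only [← mul_assoc, (hX _ _).eq]

theorem IsOff.compAt_mul_right {j : κ} {X : Matrix (κ → V) (κ → V) A} (hX : IsOff j X) (x y : V)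
    (Y : Matrix (κ → V) (κ → V) A) : CHN.compAt K j x y (Y * X) = CHN.compAt K j x y Y * X := by
  simp only [compAt_def, Finset.sum_mul]
  simp only [mul_assoc, (hX _ _).eq]

theorem compAt_unitAt_mul {j : κ} {Z : Matrix (κ → V) (κ → V) A} (hZ : IsOff j Z) (x y z w : V) :
    compAt K j x y (unitAt A j z w * Z) = if x = z then if y = w then Z else 0 else 0 := by
  rw [compAt_def]
  simp only [mul_assoc, (hZ _ _).eq]
  simp only [← mul_assoc, unitAt_mul_unitAt]
  rcases eq_or_ne x z with rfl | hx
  · rcases eq_or_ne y w with rfl | hy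
    · simp only [unitAt_mul_unitAt, if_true, ← Finset.sum_mul, sum_unitAt, one_mul]
    · simp [hy, hy.symm]
  · have (s : V) : unitAt A j s x * (if w = y then unitAt A j z s else 0) = 0 := by
      split_ifs <;> simp [unitAt_mul_unitAt, hx]
    simp [this, hx]

/-- The quantum trace with weight `D` in the tensor factor `j`, with values in operators acting as
the identity on that factor. -/
def trAt (D : Matrix V V K) (j : κ) :
    Matrix (κ → V) (κ → V) A →ₗ[K] Matrix (κ → V) (κ → V) A :=
  ∑ c, ∑ e, D c e • compAt K j e c

theorem trAt_def (D : Matrix V V K) (j : κ) (X : Matrix (κ → V) (κ → V) A) :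
    trAt D j X = ∑ c, ∑ e, D c e • compAt K j e c X := by
  simp [trAt, LinearMap.sum_apply]

theorem trAt_apply (D : Matrix V V K) (j : κ) (X : Matrix (κ → V) (κ → V) A) (a b : κ → V) :
    trAt D j X a b =
      if a j = b j then ∑ c, ∑ e, D c e • X (update a j e) (update b j c) else 0 := by
  simp only [trAt_def, compAt_def]
  simp only [Matrix.sum_apply, Matrix.smul_apply, unitAt_mul_apply, mul_unitAt_apply]
  simp [eq_comm]

theorem IsOff.trAt_mul {j : κ} {X : Matrix (κ → V) (κ → V) A} (hX : IsOff j X) (D : Matrix V V K)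
    (Y : Matrix (κ → V) (κ → V) A) : trAt D j (X * Y) = X * trAt D j Y := by
  simp only [trAt_def, Finset.mul_sum, Matrix.mul_smul, hX.compAt_mul]

theorem IsOff.trAt_mul_right {j : κ} {X : Matrix (κ → V) (κ → V) A} (hX : IsOff j X)
    (D : Matrix V V K) (Y : Matrix (κ → V) (κ → V) A) : trAt D j (Y * X) = trAt D j Y * X := by
  simp only [trAt_def, Finset.sum_mul, Matrix.smul_mul, hX.compAt_mul_right]

theorem IsOff.trAt_of_ne {i j : κ} (hij : i ≠ j) {X : Matrix (κ → V) (κ → V) A} (hX : IsOff i X)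
    (D : Matrix V V K) : IsOff i (trAt D j X) := fun x y => by
  have h := isOff_unitAt (A := A) hij x y
  rw [Commute, SemiconjBy, ← h.trAt_mul, ← h.trAt_mul_right, (hX x y).eq]

theorem trAt_unitAt (D : Matrix V V K) (j : κ) (x y : V) :
    trAt D j (unitAt A j x y) = D y x • 1 := by
  have e (c e : V) : compAt K j e c (unitAt A j x y) =
      if e = x then if c = y then 1 else 0 else 0 := by
    simpa using compAt_unitAt_mul (K := K) (IsOff.one (A := A) j) e c x y
  simp [trAt_def, e]

end Local

section Embed

open Function

variable {K : Type*} [Field K] {A : Type*} [Ring A] [Algebra K A] {V : Type*} [Fintype V]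
  [DecidableEq V] {ι κ : Type*} [Fintype ι] [DecidableEq ι] [Fintype κ] [DecidableEq κ]

open Classical in
/-- The operator on `V^{⊗κ}` which acts as `X` on the tensor factors in the range of `f` and as the
identity elsewhere. -/
def extendOp (f : ι → κ) (X : Matrix (ι → V) (ι → V) A) : Matrix (κ → V) (κ → V) A :=
  fun a b => if ∀ j ∉ Set.range f, a j = b j then X (a ∘ f) (b ∘ f) else 0

/-- The embedding of operators on `V^{⊗ι}` into operators on `V^{⊗κ}` along an injection of the
sets of tensor factors. -/
def embed (K : Type*) [Field K] [Algebra K A] (f : ι ↪ κ) :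
    Matrix (ι → V) (ι → V) A →ₐ[K] Matrix (κ → V) (κ → V) A :=
  AlgHom.ofLinearMap
    { toFun := extendOp f
      map_add' := fun X Y => by
        ext a b
        simp only [extendOp, Matrix.add_apply]
        split_ifs
        · rfl
        · exact (add_zero 0).symm
      map_smul' := fun r X => by
        ext a b
        simp only [extendOp, Matrix.smul_apply, smul_ite, smul_zero, RingHom.id_apply] }
    (by
      ext a b
      simp only [LinearMap.coe_mk, AddHom.coe_mk, Matrix.one_apply, extendOp]
      rw [← ite_and]
      congr 1
      rw [eq_iff_iff]
      refine ⟨fun ⟨h1, h2⟩ => funext fun j => ?_, fun h => by subst h; simp⟩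
      by_cases hj : j ∈ Set.range f
      · obtain ⟨i, rfl⟩ := hj
        exact congrFun h2 i
      · exact h1 j hj)
    (fun X Y => by
      ext a b
      simp only [LinearMap.coe_mk, AddHom.coe_mk, Matrix.mul_apply, extendOp]
      by_cases h : ∀ j ∉ Set.range f, a j = b j
      · rw [if_pos h]
        refine Finset.sum_of_injOn (fun d => extend f d a) ?_ (fun _ _ => Finset.mem_univ _) ?_ ?_
        · intro d _ d' _ hd
          have := congrArg (· ∘ f) hd
          rwa [extend_comp f.injective, extend_comp f.injective] at this
        · intro c _ hc
          refine (congrArg (· * _) (if_neg ?_)).trans (zero_mul _)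
          refine fun hac => hc ⟨c ∘ f, Finset.mem_coe.2 (Finset.mem_univ _), funext fun j => ?_⟩
          by_cases hj : j ∈ Set.range f
          · obtain ⟨i, rfl⟩ := hj
            exact f.injective.extend_apply _ _ _
          · exact (extend_apply' _ _ _ hj).trans (hac j hj)
        · intro d _
          have e : ∀ j ∉ Set.range f, extend f d a j = a j := fun j hj => extend_apply' _ _ _ hj
          rw [if_pos fun j hj => (e j hj).symm, if_pos fun j hj => (e j hj).trans (h j hj),
            extend_comp f.injective]
      · rw [if_neg h]
        refine (Finset.sum_eq_zero fun c _ => ?_).symm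
        by_cases h1 : ∀ j ∉ Set.range f, a j = c j
        · rw [if_neg (c := ∀ j ∉ Set.range f, c j = b j)
            fun h2 => h fun j hj => (h1 j hj).trans (h2 j hj), mul_zero]
        · rw [if_neg h1, zero_mul])

open Classical in
theorem embed_apply (f : ι ↪ κ) (X : Matrix (ι → V) (ι → V) A) (a b : κ → V) :
    embed K f X a b = if ∀ j ∉ Set.range f, a j = b j then X (a ∘ f) (b ∘ f) else 0 := rfl

theorem embed_injective [Nonempty ι] (f : ι ↪ κ) :
    Injective (embed K f : Matrix (ι → V) (ι → V) A → Matrix (κ → V) (κ → V) A) := by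
  intro X Y h
  ext a b
  obtain ⟨i⟩ := ‹Nonempty ι›
  have := congrFun (congrFun h (extend f a fun _ => a i)) (extend f b fun _ => a i)
  have e : ∀ j ∉ Set.range f, extend f a (fun _ => a i) j = extend f b (fun _ => a i) j :=
    fun j hj => by rw [extend_apply' _ _ _ hj, extend_apply' _ _ _ hj]
  rwa [embed_apply, embed_apply, if_pos e, if_pos e, extend_comp f.injective,
    extend_comp f.injective] at this

theorem embed_unitAt (f : ι ↪ κ) (i : ι) (x y : V) :
    embed K f (unitAt A i x y) = unitAt A (f i) x y := by
  ext a b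
  rw [embed_apply]
  simp only [unitAt, comp_apply, ← ite_and]
  congr 1
  rw [eq_iff_iff]
  constructor
  · rintro ⟨h, h1, h2⟩
    refine ⟨h1, funext fun j => ?_⟩
    by_cases hj : j ∈ Set.range f
    · obtain ⟨k, rfl⟩ := hj
      have := congrFun h2 k
      by_cases hk : k = i
      · subst hk; simpa using this
      · simpa [hk, f.injective.ne hk] using this
    · rw [update_of_ne (fun e => hj ⟨i, e.symm⟩), h j hj]
  · rintro ⟨h1, rfl⟩
    refine ⟨fun j hj => ?_, h1, ?_⟩
    · rw [update_of_ne (fun e => hj ⟨i, e.symm⟩)]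
    · rw [update_comp_eq_of_injective _ f.injective]

theorem isOff_embed (f : ι ↪ κ) {j : κ} (hj : j ∉ Set.range f) (X : Matrix (ι → V) (ι → V) A) :
    IsOff j (embed K f X) := by
  intro x y
  ext a b
  rw [mul_unitAt_apply, unitAt_mul_apply, embed_apply, embed_apply]
  have e (c : κ → V) (z : V) : update c j z ∘ f = c ∘ f := funext fun i =>
    update_of_ne (fun e => hj ⟨i, e⟩) _ _
  simp only [e, ← ite_and]
  congr 1
  rw [eq_iff_iff]
  constructor
  · rintro ⟨rfl, h⟩
    have h0 := h j hj
    rw [update_self] at h0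
    refine ⟨h0, fun k hk => ?_⟩
    by_cases hkj : k = j
    · subst hkj; simp
    · simpa [hkj] using h k hk
  · rintro ⟨rfl, h⟩
    have h0 := h j hj
    rw [update_self] at h0
    refine ⟨h0.symm, fun k hk => ?_⟩
    by_cases hkj : k = j
    · subst hkj; simp
    · simpa [hkj] using h k hk

theorem trAt_embed (D : Matrix V V K) (f : ι ↪ κ) (i : ι) (X : Matrix (ι → V) (ι → V) A) :
    trAt D (f i) (embed K f X) = embed K f (trAt D i X) := by
  simp only [trAt_def, compAt_def, map_sum, map_smul, map_mul, embed_unitAt]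

end Embed

section Site

open Function

variable {K : Type*} [Field K] {A : Type*} [Ring A] [Algebra K A] {N : ℕ}

/-- The embedding of `Fin k` into `Fin n` shifted by `p`. -/
def shiftEmb {p k n : ℕ} (h : p + k ≤ n) : Fin k ↪ Fin n where
  toFun i := ⟨p + i, by omega⟩
  inj' i j hij := by simpa [Fin.ext_iff] using hij

theorem val_shiftEmb {p k n : ℕ} (h : p + k ≤ n) (i : Fin k) : (shiftEmb h i : ℕ) = p + i := rfl

theorem mem_range_shiftEmb {p k n : ℕ} (h : p + k ≤ n) (j : Fin n) :
    j ∈ Set.range (shiftEmb h) ↔ p ≤ j ∧ (j : ℕ) < p + k := by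
  constructor
  · rintro ⟨i, rfl⟩
    rw [val_shiftEmb]
    omega
  · rintro ⟨h1, h2⟩
    exact ⟨⟨j - p, by omega⟩, Fin.ext (Nat.add_sub_cancel' h1)⟩

theorem embed_site {p k n i : ℕ} (h : p + k ≤ n) (hi : i + 1 < k) (X : M2 N A) :
    embed K (shiftEmb h) (site k i X) = site n (p + i) X := by
  ext a b
  have hn : p + i + 1 < n := by omega
  rw [embed_apply, site, site, dif_pos hi, dif_pos hn]
  simp only [mem_range_shiftEmb, mul_ite, mul_one, mul_zero, ← ite_and]
  congr 1
  rw [eq_iff_iff]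
  constructor
  · rintro ⟨h1, h2⟩ j hj hj'
    by_cases hr : p ≤ j ∧ (j : ℕ) < p + k
    · have := h2 ⟨j - p, by omega⟩ (by simp; omega) (by simp; omega)
      have e : shiftEmb h ⟨j - p, by omega⟩ = j := Fin.ext (Nat.add_sub_cancel' hr.1)
      simpa only [comp_apply, e] using this
    · exact h1 j hr
  · refine fun h1 => ⟨fun j hj => h1 j (by omega) (by omega), fun j hj hj' => h1 _ ?_ ?_⟩
    · rw [val_shiftEmb]; omega
    · rw [val_shiftEmb]; omega

theorem embed_site1 {k n i : ℕ} (h : 0 + k ≤ n) (hi : i < k) (X : Matrix (Fin N) (Fin N) A) :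
    embed K (shiftEmb h) (site1 k i X) = site1 n i X := by
  ext a b
  have hn : i < n := by omega
  have e (j : Fin k) : shiftEmb h j = ⟨j, by omega⟩ := Fin.ext (Nat.zero_add _)
  rw [embed_apply, site1, site1, dif_pos hi, dif_pos hn]
  simp only [mem_range_shiftEmb, mul_ite, mul_one, mul_zero, ← ite_and, comp_apply, e]
  congr 1
  rw [eq_iff_iff]
  constructor
  · rintro ⟨h1, h2⟩ j hj
    by_cases hr : (j : ℕ) < k
    · exact h2 ⟨j, hr⟩ hj
    · exact h1 j (by omega)
  · exact fun h1 => ⟨fun j hj => h1 j (by omega), fun j hj => h1 _ hj⟩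

variable (A) in
/-- The operator `X` with central entries placed at the tensor factors `i` and `i + 1`. -/
def siteHom {n i : ℕ} (h : i + 2 ≤ n) : M2 N K →ₐ[K] Op N A n :=
  (embed K (shiftEmb h)).comp ((Algebra.ofId K A).mapMatrix.comp
    (Matrix.reindexAlgEquiv K K (finTwoArrowEquiv (Fin N)).symm : M2 N K →ₐ[K] Op N K 2))

theorem siteHom_apply {n i : ℕ} (h : i + 2 ≤ n) (X : M2 N K) :
    siteHom A h X = site n i (X.map (algebraMap K A)) := by
  refine Eq.trans ?_ (embed_site (K := K) h (by omega : 0 + 1 < 2) _)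
  refine congrArg (embed K (shiftEmb h)) ?_
  ext a b
  rw [site, dif_pos (by omega), if_pos (fun j h0 h1 => by omega), mul_one]
  rfl

theorem embed_siteHom {p k n i : ℕ} (h : p + k ≤ n) (hi : i + 2 ≤ k) (X : M2 N K) :
    embed K (shiftEmb h) (siteHom A hi X) = siteHom A (by omega : p + i + 2 ≤ n) X := by
  rw [siteHom_apply, siteHom_apply, embed_site h hi]

theorem siteHom_eq_sum {n i : ℕ} (h : i + 2 ≤ n) (X : M2 N K) :
    siteHom A h X = ∑ x, ∑ y, ∑ z, ∑ w, X (x, z) (y, w) •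
      (unitAt A (⟨i, by omega⟩ : Fin n) x y * unitAt A (⟨i + 1, by omega⟩ : Fin n) z w) := by
  have key : siteHom A (le_refl (0 + 2)) X = ∑ x, ∑ y, ∑ z, ∑ w, X (x, z) (y, w) •
      (unitAt A (0 : Fin 2) x y * unitAt A (1 : Fin 2) z w) := by
    ext a b
    have e (y z w : Fin N) : unitAt A (1 : Fin 2) z w (update a 0 y) b =
        if w = b 1 then if y = b 0 then if z = a 1 then 1 else 0 else 0 else 0 := by
      rw [unitAt, ← ite_and, ← ite_and]
      congr 1
      rw [eq_iff_iff, funext_iff, Fin.forall_fin_two]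
      simp [eq_comm]
      tauto
    rw [siteHom_apply, site, dif_pos (by omega), if_pos (fun j h0 h1 => by omega), mul_one]
    simp only [Matrix.sum_apply, Matrix.smul_apply, unitAt_mul_apply, e, smul_ite, smul_zero,
      Finset.sum_ite_eq', Finset.sum_ite_eq, Finset.mem_univ, if_true,
      Finset.sum_const_zero, Finset.sum_ite_irrel, ← Algebra.algebraMap_eq_smul_one]
    rfl
  have := congrArg (embed K (shiftEmb h)) key
  rw [embed_siteHom] at this
  simp only [map_sum, map_smul, map_mul, embed_unitAt] at this
  exact this

theorem isOff_siteHom {n i : ℕ} (h : i + 2 ≤ n) (X : M2 N K) {j : Fin n} (hj : (j : ℕ) ≠ i)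
    (hj' : (j : ℕ) ≠ i + 1) : IsOff j (siteHom A h X) :=
  isOff_embed (K := K) _ (by rw [mem_range_shiftEmb]; omega) _

theorem commute_siteHom {n i : ℕ} (h : i + 2 ≤ n) (X : M2 N K) {Z : Op N A n}
    (h0 : IsOff ⟨i, by omega⟩ Z) (h1 : IsOff ⟨i + 1, by omega⟩ Z) : Commute Z (siteHom A h X) := by
  rw [siteHom_eq_sum]
  exact Commute.sum_right _ _ _ fun x _ => Commute.sum_right _ _ _ fun y _ =>
    Commute.sum_right _ _ _ fun z _ => Commute.sum_right _ _ _ fun w _ =>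
      ((h0 x y).mul_right (h1 z w)).smul_right _

/-! ### Closed R-matrices -/

theorem sum_mul_Dmat {F Ψ : M2 N K} (hΨ : IsClosedPair F Ψ) (x y : Fin N) :
    ∑ z, ∑ w, F (x, z) (y, w) * Dmat Ψ w z = if x = y then 1 else 0 := by
  let P : M2 N K := fun a f => Ψ (a.1, f.1) (a.2, f.2)
  let Q : M2 N K := fun f d => F (f.2, d.2) (f.1, d.1)
  have hPQ : P * Q = 1 := by
    ext ⟨a, c⟩ ⟨d, b⟩
    rw [Matrix.mul_apply, Fintype.sum_prod_type, Matrix.one_apply]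
    simpa [eq_comm (a := b)] using hΨ a b c d
  have hQP : Q * P = 1 := mul_eq_one_comm.1 hPQ
  have key (c : Fin N) : ∑ w, ∑ z, F (x, z) (y, w) * Ψ (w, c) (z, c) =
      if c = x then if x = y then 1 else 0 else 0 := by
    have := congrFun (congrFun hQP (y, x)) (c, c)
    rw [Matrix.mul_apply, Fintype.sum_prod_type, Matrix.one_apply] at this
    refine this.trans ?_
    rw [← ite_and]
    congr 1
    simp only [Prod.mk.injEq, eq_iff_iff]
    constructor
    · rintro ⟨rfl, rfl⟩; simp
    · rintro ⟨rfl, rfl⟩; simp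
  simp only [Dmat, Finset.mul_sum]
  rw [Finset.sum_comm_cycle, Finset.sum_congr rfl fun c _ => Finset.sum_comm.trans (key c)]
  simp

theorem compAt_siteHom {n i : ℕ} (h : i + 2 ≤ n) (X : M2 N K) (x y : Fin N) :
    compAt K ⟨i, by omega⟩ x y (siteHom A h X) =
      ∑ z, ∑ w, X (x, z) (y, w) • unitAt A (⟨i + 1, by omega⟩ : Fin n) z w := by
  have hij : (⟨i + 1, by omega⟩ : Fin n) ≠ ⟨i, by omega⟩ := by simp
  rw [siteHom_eq_sum]
  simp only [map_sum, map_smul, compAt_unitAt_mul (isOff_unitAt hij _ _), smul_ite, smul_zero,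
      Finset.sum_ite_eq, Finset.mem_univ, if_true, Finset.sum_const_zero, Finset.sum_ite_irrel]

theorem unitAt_succ_eq_sum {F Ψ : M2 N K} (hΨ : IsClosedPair F Ψ) {n i : ℕ} (h : i + 2 ≤ n)
    (z w : Fin N) :
    unitAt A (⟨i + 1, by omega⟩ : Fin n) z w =
      ∑ r, ∑ p, Ψ (w, r) (z, p) • compAt K ⟨i, by omega⟩ p r (siteHom A h F) := by
  simp only [compAt_siteHom, Finset.smul_sum, smul_smul]
  have hΨ' (a b c d : Fin N) : ∑ f, ∑ g, Ψ (a, f) (c, g) * F (g, b) (f, d) =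
      if a = d ∧ b = c then 1 else 0 := hΨ a b c d
  rw [Finset.sum_comm_cycle, Finset.sum_congr rfl fun _ _ => Finset.sum_comm_cycle]
  simp only [← Finset.sum_smul, hΨ']
  simp only [ite_and, ite_smul, one_smul, zero_smul, Finset.sum_ite_eq, Finset.sum_ite_eq',
    Finset.mem_univ, if_true]

theorem trAt_siteHom {F Ψ : M2 N K} (hΨ : IsClosedPair F Ψ) {n i : ℕ} (h : i + 2 ≤ n) :
    trAt (Dmat Ψ) ⟨i + 1, by omega⟩ (siteHom A h F) = 1 := by
  have hoff (x y : Fin N) : IsOff (⟨i + 1, by omega⟩ : Fin n)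
      (unitAt A (⟨i, by omega⟩ : Fin n) x y) := isOff_unitAt (by simp) x y
  rw [siteHom_eq_sum]
  simp only [map_sum, map_smul, (hoff _ _).trAt_mul, trAt_unitAt, Matrix.mul_smul, mul_one,
    smul_smul, ← Finset.sum_smul, sum_mul_Dmat hΨ, ite_smul, one_smul, zero_smul, Finset.sum_ite_eq,
    Finset.mem_univ, if_true, sum_unitAt]

end Site

section Trace

open Function

variable {K : Type*} [Field K] {A : Type*} [Ring A] [Algebra K A] {N : ℕ}

theorem trAt_compAt {κ V : Type*} [Fintype κ] [DecidableEq κ] [Fintype V] [DecidableEq V]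
    (D : Matrix V V K) {i j : κ} (hij : i ≠ j) (x y : V) (X : Matrix (κ → V) (κ → V) A) :
    trAt D i (compAt K j x y X) = compAt K j x y (trAt D i X) := by
  simp only [compAt_def, map_sum, (isOff_unitAt hij.symm _ _).trAt_mul,
    (isOff_unitAt hij.symm _ _).trAt_mul_right]

theorem compAt_one {κ V : Type*} [Fintype κ] [DecidableEq κ] [Fintype V] [DecidableEq V]
    (j : κ) (x y : V) : compAt K j x y (1 : Matrix (κ → V) (κ → V) A) =
      if x = y then 1 else 0 := by
  simp only [compAt_def, one_mul, unitAt_mul_unitAt]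
  split_ifs <;> simp [sum_unitAt]

theorem site_map (n i : ℕ) (X : M2 N K) :
    (site n i X).map (algebraMap K A) = site n i (X.map (algebraMap K A)) := by
  ext a b
  simp only [Matrix.map_apply, site]
  split_ifs <;> simp

theorem siteHom_braid {X Y Z X' Y' Z' : M2 N K}
    (hrel : site 3 0 X * site 3 1 Y * site 3 0 Z = site 3 1 X' * site 3 0 Y' * site 3 1 Z')
    {n i : ℕ} (h : i + 2 ≤ n) (h' : i + 1 + 2 ≤ n) :
    siteHom A h X * siteHom A h' Y * siteHom A h Z =
      siteHom A h' X' * siteHom A h Y' * siteHom A h' Z' := by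
  have h0 : 0 + 2 ≤ 3 := by omega
  have h1 : 1 + 2 ≤ 3 := by omega
  have := congrArg (embed K (shiftEmb (show i + 3 ≤ n by omega)))
    (congrArg (algebraMap K A).mapMatrix hrel)
  simp only [map_mul, RingHom.mapMatrix_apply, site_map, ← siteHom_apply h0,
    ← siteHom_apply h1, embed_siteHom] at this
  exact this

theorem siteHom_mul_eq_one {X Y : M2 N K} (hXY : X * Y = 1) {n i : ℕ} (h : i + 2 ≤ n) :
    siteHom A h X * siteHom A h Y = 1 := by
  rw [← map_mul, hXY, map_one]

theorem trAt_conj_unitAt {F G Ψ : M2 N K} (hΨ : IsClosedPair F Ψ) (hF : YB F) (hFG : F * G = 1)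
    {n i : ℕ} (h : i + 2 ≤ n) (x y : Fin N) :
    trAt (Dmat Ψ) ⟨i + 1, by omega⟩
      (siteHom A h F * unitAt A ⟨i, by omega⟩ x y * siteHom A h G) = Dmat Ψ y x • 1 := by
  have key : trAt (Dmat Ψ) (2 : Fin 3) (siteHom A (show 1 + 2 ≤ 3 by omega) F *
      unitAt A (1 : Fin 3) x y * siteHom A (show 1 + 2 ≤ 3 by omega) G) = Dmat Ψ y x • 1 := by
    set F1 := siteHom A (show 1 + 2 ≤ 3 by omega) F
    set G1 := siteHom A (show 1 + 2 ≤ 3 by omega) G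
    set F0 := siteHom A (show 0 + 2 ≤ 3 by omega) F
    set G0 := siteHom A (show 0 + 2 ≤ 3 by omega) G
    have hGF0 : G0 * F0 = 1 := siteHom_mul_eq_one (mul_eq_one_comm.1 hFG) _
    have hFG1 : F1 * G1 = 1 := siteHom_mul_eq_one hFG _
    have off1 : IsOff (0 : Fin 3) F1 := isOff_siteHom _ _ (by simp) (by simp)
    have off2 : IsOff (0 : Fin 3) G1 := isOff_siteHom _ _ (by simp) (by simp)
    have off3 : IsOff (2 : Fin 3) F0 := isOff_siteHom _ _ (by simp) (by simp)
    have off4 : IsOff (2 : Fin 3) G0 := isOff_siteHom _ _ (by simp) (by simp)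
    have e : F1 * F0 * G1 = G0 * (F1 * F0) := by
      have : F0 * F1 * F0 = F1 * F0 * F1 := siteHom_braid hF _ _
      have := congrArg (fun z => G0 * z * G1) this
      simp only [mul_assoc, hFG1, mul_one] at this
      rw [← mul_assoc G0 F0, hGF0, one_mul] at this
      rw [mul_assoc, this]
    have e' : trAt (Dmat Ψ) (2 : Fin 3) (F1 * F0 * G1) = 1 := by
      rw [e, off4.trAt_mul, off3.trAt_mul_right, ← hGF0]
      exact congrArg (G0 * ·) ((congrArg (· * F0) (trAt_siteHom hΨ _)).trans (one_mul _))
    have hu : unitAt A (1 : Fin 3) x y = ∑ r, ∑ p, Ψ (y, r) (x, p) • compAt K 0 p r F0 :=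
      unitAt_succ_eq_sum hΨ _ x y
    have hc (p r : Fin N) : trAt (Dmat Ψ) (2 : Fin 3) (F1 * compAt K 0 p r F0 * G1) =
        if p = r then 1 else 0 := by
      rw [← off1.compAt_mul, ← off2.compAt_mul_right, trAt_compAt _ (by decide), e', compAt_one]
    rw [hu]
    simp only [Finset.mul_sum, Finset.sum_mul, Matrix.mul_smul, Matrix.smul_mul, map_sum, map_smul,
      hc]
    simp [Dmat, Finset.sum_smul]
  have key2 : trAt (Dmat Ψ) (1 : Fin 2) (siteHom A (show 0 + 2 ≤ 2 by omega) F *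
      unitAt A (0 : Fin 2) x y * siteHom A (show 0 + 2 ≤ 2 by omega) G) = Dmat Ψ y x • 1 := by
    apply embed_injective (K := K) (shiftEmb (show 1 + 2 ≤ 3 by omega))
    rw [← trAt_embed, map_mul (embed K _), map_mul (embed K _), embed_siteHom, embed_siteHom,
      embed_unitAt, map_smul (embed K _),
      map_one (embed K _)]
    exact key
  have := congrArg (embed K (shiftEmb h)) key2
  rw [← trAt_embed, map_mul (embed K _), map_mul (embed K _), embed_siteHom, embed_siteHom,
      embed_unitAt, map_smul (embed K _),
      map_one (embed K _)] at this
  exact this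

theorem trAt_conj {F G Ψ : M2 N K} (hΨ : IsClosedPair F Ψ) (hF : YB F) (hFG : F * G = 1)
    {n i : ℕ} (h : i + 2 ≤ n) {X : Op N A n} (hX : IsOff ⟨i + 1, by omega⟩ X) :
    trAt (Dmat Ψ) ⟨i + 1, by omega⟩ (siteHom A h F * X * siteHom A h G) =
      trAt (Dmat Ψ) ⟨i, by omega⟩ X := by
  have hne : (⟨i + 1, by omega⟩ : Fin n) ≠ ⟨i, by omega⟩ := by simp
  have h0 (x y) : IsOff ⟨i, by omega⟩ (compAt K ⟨i, by omega⟩ x y X) := isOff_compAt K _ _ _ _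
  have h1 (x y) : IsOff ⟨i + 1, by omega⟩ (compAt K ⟨i, by omega⟩ x y X) := hX.compAt K hne x y
  have hX' := sum_unitAt_mul_compAt K (⟨i, by omega⟩ : Fin n) X
  conv_lhs => rw [← hX']
  conv_rhs => rw [← hX']
  simp only [Finset.mul_sum, Finset.sum_mul, map_sum]
  refine Finset.sum_congr rfl fun x _ => Finset.sum_congr rfl fun y _ => ?_
  rw [(h0 x y).trAt_mul_right, trAt_unitAt, mul_assoc, mul_assoc,
    (commute_siteHom h G (h0 x y) (h1 x y)).eq, ← mul_assoc, ← mul_assoc, (h1 x y).trAt_mul_right,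
    trAt_conj_unitAt hΨ hF hFG]

end Trace

section Exchange

variable {K : Type*} [Field K] {A : Type*} [Ring A] [Algebra K A] {N : ℕ}

variable (A) in
/-- The operators `X` with `Tr_{i,i+1} (Y_i X) = Tr_{i,i+1} (X Z_i)`. -/
def traceExchange (D : Matrix (Fin N) (Fin N) K) (Y Z : M2 N K) {n i : ℕ} (h : i + 2 ≤ n) :
    Submodule K (Op N A n) :=
  LinearMap.eqLocus
    (trAt D ⟨i, by omega⟩ ∘ₗ trAt D ⟨i + 1, by omega⟩ ∘ₗ LinearMap.mulLeft K (siteHom A h Y))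
    (trAt D ⟨i, by omega⟩ ∘ₗ trAt D ⟨i + 1, by omega⟩ ∘ₗ LinearMap.mulRight K (siteHom A h Z))

variable {D : Matrix (Fin N) (Fin N) K} {Y Z : M2 N K} {n i : ℕ} {h : i + 2 ≤ n}

theorem mem_traceExchange {X : Op N A n} : X ∈ traceExchange A D Y Z h ↔
    trAt D ⟨i, by omega⟩ (trAt D ⟨i + 1, by omega⟩ (siteHom A h Y * X)) =
      trAt D ⟨i, by omega⟩ (trAt D ⟨i + 1, by omega⟩ (X * siteHom A h Z)) := Iff.rfl

theorem mul_right_mem_traceExchange {C X : Op N A n} (h0 : IsOff ⟨i, by omega⟩ C)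
    (h1 : IsOff ⟨i + 1, by omega⟩ C) (hX : X ∈ traceExchange A D Y Z h) :
    X * C ∈ traceExchange A D Y Z h := by
  rw [mem_traceExchange] at hX ⊢
  rw [mul_assoc, (commute_siteHom h Z h0 h1).eq, ← mul_assoc, ← mul_assoc, h1.trAt_mul_right,
    h1.trAt_mul_right, h0.trAt_mul_right, h0.trAt_mul_right, hX]

theorem compAt_mem_traceExchange {X : Op N A n} {j : Fin n} (hj : (j : ℕ) ≠ i)
    (hj' : (j : ℕ) ≠ i + 1) (x y : Fin N) (hX : X ∈ traceExchange A D Y Z h) :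
    compAt K j x y X ∈ traceExchange A D Y Z h := by
  rw [mem_traceExchange] at hX ⊢
  have hne : (⟨i, by omega⟩ : Fin n) ≠ j := fun e => hj (by simp [← e])
  have hne' : (⟨i + 1, by omega⟩ : Fin n) ≠ j := fun e => hj' (by simp [← e])
  rw [← (isOff_siteHom h Y hj hj').compAt_mul, ← (isOff_siteHom h Z hj hj').compAt_mul_right,
    trAt_compAt _ hne', trAt_compAt _ hne', trAt_compAt _ hne, trAt_compAt _ hne, hX]

end Exchange

section Exchange

variable {K : Type*} [Field K] {A : Type*} [Ring A] [Algebra K A] {N : ℕ}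

theorem unitAt_succ_mem {F Ψ : M2 N K} (hΨ : IsClosedPair F Ψ) {n j : ℕ} (hj : j + 2 ≤ n)
    {S : Submodule K (Op N A n)} {B C : Op N A n}
    (hS : ∀ x y, B * compAt K ⟨j, by omega⟩ x y (siteHom A hj F) * C ∈ S) (z w : Fin N) :
    B * unitAt A ⟨j + 1, by omega⟩ z w * C ∈ S := by
  rw [unitAt_succ_eq_sum hΨ hj]
  simp only [Finset.mul_sum, Finset.sum_mul, Matrix.mul_smul, Matrix.smul_mul]
  exact S.sum_mem fun r _ => S.sum_mem fun p _ => S.smul_mem _ (hS p r)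

theorem unitAt_mul_mem_traceExchange_four {R F G Ψ : M2 N K} (hΨ : IsClosedPair F Ψ)
    (hc : Compatible R F) (hFG : F * G = 1) (x y z w : Fin N) :
    unitAt A (2 : Fin 4) x y * unitAt A (3 : Fin 4) z w ∈
      traceExchange A (Dmat Ψ) R (F * (F * R * G) * G) (show 2 + 2 ≤ 4 by omega) := by
  obtain ⟨-, hF, hd, hu⟩ := hc
  set Q := traceExchange A (Dmat Ψ) R (F * (F * R * G) * G) (show 2 + 2 ≤ 4 by omega)
  have l0 : 0 + 2 ≤ 4 := by omega
  have l1 : 1 + 2 ≤ 4 := by omega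
  have l2 : 2 + 2 ≤ 4 := by omega
  set F0 := siteHom A l0 F
  set F1 := siteHom A l1 F
  set F2 := siteHom A l2 F
  have GF0 : siteHom A l0 G * F0 = 1 := siteHom_mul_eq_one (mul_eq_one_comm.1 hFG) _
  have FG2 : F2 * siteHom A l2 G = 1 := siteHom_mul_eq_one hFG _
  have F02 : F2 * F0 = F0 * F2 := (commute_siteHom l0 F
    (isOff_siteHom l2 F (by simp) (by simp)) (isOff_siteHom l2 F (by simp) (by simp))).eq
  have F010 : F0 * F1 * F0 = F1 * F0 * F1 := siteHom_braid hF l0 l1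
  have F121 : F1 * F2 * F1 = F2 * F1 * F2 := siteHom_braid hF l1 l2
  have offF1 : IsOff (0 : Fin 4) F1 := isOff_siteHom _ _ (by simp) (by simp)
  have offF2 : IsOff (0 : Fin 4) F2 := isOff_siteHom _ _ (by simp) (by simp)
  have offF2' : IsOff (1 : Fin 4) F2 := isOff_siteHom _ _ (by simp) (by simp)
  have hW : F1 * F2 * F0 * F1 ∈ Q := by
    have W : F1 * F2 * F0 * F1 = F1 * F0 * (F2 * F1) := by
      rw [mul_assoc F1, F02]
      simp only [mul_assoc]
    have up {i : ℕ} (h : i + 2 ≤ 4) (h' : i + 1 + 2 ≤ 4) : SemiconjBy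
        (siteHom A h F * siteHom A h' F) (siteHom A h R) (siteHom A h' R) :=
      (siteHom_braid hu h h').trans (mul_assoc _ _ _)
    have down {X : M2 N K} (hX : site 3 0 X * site 3 1 F * site 3 0 F =
        site 3 1 F * site 3 0 F * site 3 1 X) {i : ℕ} (h : i + 2 ≤ 4) (h' : i + 1 + 2 ≤ 4) :
        SemiconjBy (siteHom A h' F * siteHom A h F) (siteHom A h' X) (siteHom A h X) :=
      (siteHom_braid hX h h').symm.trans (mul_assoc _ _ _)
    have hup : SemiconjBy (F1 * F2 * (F0 * F1)) (siteHom A l0 R) (siteHom A l2 R) :=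
      (up l1 l2).mul_left (up l0 l1)
    have hdR : SemiconjBy (F1 * F0 * (F2 * F1)) (siteHom A l2 R) (siteHom A l0 R) :=
      (down hd l0 l1).mul_left (down hd l1 l2)
    have hdF : SemiconjBy (F1 * F0 * (F2 * F1)) F2 F0 :=
      (down hF l0 l1).mul_left (down hF l1 l2)
    have hdG : SemiconjBy (F1 * F0 * (F2 * F1)) (siteHom A l2 G) (siteHom A l0 G) :=
      semiconjBy_of_mul_eq_one FG2 GF0 hdF
    have tr : trAt (Dmat Ψ) (2 : Fin 4) (trAt (Dmat Ψ) (3 : Fin 4) (F1 * F2 * F0 * F1)) =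
        F0 * F0 := by
      have t1 : trAt (Dmat Ψ) (3 : Fin 4) F2 = 1 := trAt_siteHom hΨ l2
      have t2 : trAt (Dmat Ψ) (2 : Fin 4) F1 = 1 := trAt_siteHom hΨ l1
      have o1 : IsOff (3 : Fin 4) F1 := isOff_siteHom _ _ (by simp) (by simp)
      have o2 : IsOff (3 : Fin 4) F0 := isOff_siteHom _ _ (by simp) (by simp)
      have o3 : IsOff (2 : Fin 4) F0 := isOff_siteHom _ _ (by simp) (by simp)
      rw [o1.trAt_mul_right, o2.trAt_mul_right, o1.trAt_mul, t1, mul_one, ← F010,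
        o3.trAt_mul_right, o3.trAt_mul, t2, mul_one]
    have oR : IsOff (2 : Fin 4) (siteHom A l0 R) := isOff_siteHom _ _ (by simp) (by simp)
    have oR' : IsOff (3 : Fin 4) (siteHom A l0 R) := isOff_siteHom _ _ (by simp) (by simp)
    have oX : IsOff (2 : Fin 4) (siteHom A l0 (F * (F * R * G) * G)) :=
      isOff_siteHom _ _ (by simp) (by simp)
    have oX' : IsOff (3 : Fin 4) (siteHom A l0 (F * (F * R * G) * G)) :=
      isOff_siteHom _ _ (by simp) (by simp)
    have e1 : siteHom A l2 R * (F1 * F2 * F0 * F1) = F1 * F2 * F0 * F1 * siteHom A l0 R := by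
      rw [mul_assoc (F1 * F2), hup.eq]
    have e2 : F1 * F2 * F0 * F1 * siteHom A l2 (F * (F * R * G) * G) =
        siteHom A l0 (F * (F * R * G) * G) * (F1 * F2 * F0 * F1) := by
      rw [W]
      simp only [map_mul]
      exact ((hdF.mul_right ((hdF.mul_right hdR).mul_right hdG)).mul_right hdG).eq
    have e3 : siteHom A l0 (F * (F * R * G) * G) * (F0 * F0) = F0 * F0 * siteHom A l0 R := by
      simp only [map_mul, mul_assoc]
      rw [← mul_assoc _ F0 F0, GF0, one_mul, GF0, mul_one]
    refine mem_traceExchange.2 ?_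
    rw [e1, e2]
    exact (congrArg _ (oR'.trAt_mul_right _ _)).trans ((oR.trAt_mul_right _ _).trans
      ((congrArg (· * _) tr).trans (e3.symm.trans ((congrArg (_ * ·) tr.symm).trans
      ((oX.trAt_mul _ _).symm.trans (congrArg _ (oX'.trAt_mul _ _).symm))))))
  have s1 (x y) : F1 * F2 * unitAt A (1 : Fin 4) x y * F1 ∈ Q := by
    refine unitAt_succ_mem hΨ l0 (fun x y => ?_) x y
    have := compAt_mem_traceExchange (j := 0) (by simp) (by simp) x y hW
    rwa [offF1.compAt_mul_right, (offF1.mul offF2).compAt_mul] at this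
  have s2 (x y) : F1 * F2 * unitAt A (2 : Fin 4) x y * 1 ∈ Q := by
    refine unitAt_succ_mem hΨ l1 (fun x y => ?_) x y
    rw [mul_one, compAt_def, Finset.mul_sum]
    refine Q.sum_mem fun s _ => ?_
    simp only [← mul_assoc]
    exact mul_right_mem_traceExchange (isOff_unitAt (by simp) _ _) (isOff_unitAt (by simp) _ _)
      (s1 _ _)
  have s3 (x y a b) : 1 * unitAt A (2 : Fin 4) x y * (F2 * unitAt A (2 : Fin 4) a b) ∈ Q := by
    refine unitAt_succ_mem hΨ l1 (fun x y => ?_) x y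
    have o : IsOff (1 : Fin 4) (F2 * unitAt A (2 : Fin 4) a b) :=
      offF2'.mul (isOff_unitAt (by decide) _ _)
    have := compAt_mem_traceExchange (j := 1) (by simp) (by simp) x y (s2 a b)
    rw [mul_one, mul_assoc F1, o.compAt_mul_right] at this
    rwa [one_mul]
  have := unitAt_succ_mem hΨ l2 (S := Q) (B := unitAt A (2 : Fin 4) x y) (C := 1)
    (fun a b => ?_) z w
  · rwa [mul_one] at this
  · rw [mul_one, compAt_def, Finset.mul_sum]
    refine Q.sum_mem fun s _ => ?_
    rw [← mul_assoc]
    change unitAt A (2 : Fin 4) x y * unitAt A (2 : Fin 4) s a * _ ∈ Q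
    rw [unitAt_mul_unitAt]
    split_ifs
    · simpa using s3 x a b s
    · simp

theorem embed_mem_traceExchange {Y Z : M2 N K} {D : Matrix (Fin N) (Fin N) K} {p k n i : ℕ}
    (h : p + k ≤ n) (hi : i + 2 ≤ k) (X : Op N A k) :
    embed K (shiftEmb h) X ∈ traceExchange A D Y Z (by omega : p + i + 2 ≤ n) ↔
      X ∈ traceExchange A D Y Z hi := by
  have : Nonempty (Fin k) := ⟨⟨i, by omega⟩⟩
  rw [mem_traceExchange, mem_traceExchange, ← (embed_injective (K := K) (shiftEmb h)).eq_iff,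
    ← trAt_embed, ← trAt_embed, ← trAt_embed, ← trAt_embed, map_mul (embed K _),
    map_mul (embed K _), embed_siteHom h hi, embed_siteHom h hi]
  exact Iff.rfl

theorem unitAt_mul_mem_traceExchange {R F G Ψ : M2 N K} (hΨ : IsClosedPair F Ψ)
    (hc : Compatible R F) (hFG : F * G = 1) {n i : ℕ} (h : i + 2 ≤ n) (x y z w : Fin N) :
    unitAt A (⟨i, by omega⟩ : Fin n) x y * unitAt A (⟨i + 1, by omega⟩ : Fin n) z w ∈
      traceExchange A (Dmat Ψ) R (F * (F * R * G) * G) h := by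
  have e {n i : ℕ} (h : i + 2 ≤ n) : embed K (shiftEmb h)
      (unitAt A (0 : Fin 2) x y * unitAt A (1 : Fin 2) z w) =
        unitAt A (⟨i, by omega⟩ : Fin n) x y * unitAt A (⟨i + 1, by omega⟩ : Fin n) z w := by
    rw [map_mul, embed_unitAt, embed_unitAt]
    rfl
  rw [← e h]
  refine (embed_mem_traceExchange h (le_refl (0 + 2)) _).2
    ((embed_mem_traceExchange (show 2 + 2 ≤ 4 by omega) (le_refl (0 + 2)) _).1 ?_)
  rw [e]
  exact unitAt_mul_mem_traceExchange_four hΨ hc hFG x y z w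

theorem mem_traceExchange_of_forall_unitAt {Y Z : M2 N K} {D : Matrix (Fin N) (Fin N) K} {n i : ℕ}
    (h : i + 2 ≤ n) (hS : ∀ x y z w, unitAt A (⟨i, by omega⟩ : Fin n) x y *
      unitAt A (⟨i + 1, by omega⟩ : Fin n) z w ∈ traceExchange A D Y Z h) (X : Op N A n) :
    X ∈ traceExchange A D Y Z h := by
  have hne : (⟨i + 1, by omega⟩ : Fin n) ≠ ⟨i, by omega⟩ := by simp
  rw [← sum_unitAt_mul_compAt K ⟨i, by omega⟩ X]
  refine Submodule.sum_mem _ fun x _ => Submodule.sum_mem _ fun y _ => ?_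
  rw [← sum_unitAt_mul_compAt K ⟨i + 1, by omega⟩ (compAt K ⟨i, by omega⟩ x y X), Finset.mul_sum]
  refine Submodule.sum_mem _ fun z _ => ?_
  rw [Finset.mul_sum]
  refine Submodule.sum_mem _ fun w _ => ?_
  rw [← mul_assoc]
  have o1 := (isOff_compAt K (⟨i, by omega⟩ : Fin n) x y X).compAt K hne.symm z w
  have o2 := isOff_compAt K (⟨i + 1, by omega⟩ : Fin n) z w (compAt K ⟨i, by omega⟩ x y X)
  exact mul_right_mem_traceExchange o1 o2 (hS x y z w)

theorem trAt_trAt_exchange {R F G Ψ : M2 N K} (hΨ : IsClosedPair F Ψ) (hc : Compatible R F)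
    (hFG : F * G = 1) {n i : ℕ} (h : i + 2 ≤ n) (X : Op N A n) :
    trAt (Dmat Ψ) ⟨i, by omega⟩ (trAt (Dmat Ψ) ⟨i + 1, by omega⟩ (siteHom A h R * X)) =
      trAt (Dmat Ψ) ⟨i, by omega⟩
        (trAt (Dmat Ψ) ⟨i + 1, by omega⟩ (X * siteHom A h (F * (F * R * G) * G))) := by
  exact mem_traceExchange.1 (mem_traceExchange_of_forall_unitAt h
    (unitAt_mul_mem_traceExchange hΨ hc hFG h) X)

end Exchange

section TraceSegment

open Function

variable {K : Type*} [Field K] {A : Type*} [Ring A] [Algebra K A] {N : ℕ}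

/-- The quantum trace in the tensor factor `j` (the identity map when `j` is out of range). -/
def trSite (D : Matrix (Fin N) (Fin N) K) (n j : ℕ) : Op N A n →ₗ[K] Op N A n :=
  if h : j < n then trAt D ⟨j, h⟩ else LinearMap.id

theorem trSite_of_lt (D : Matrix (Fin N) (Fin N) K) {n j : ℕ} (h : j < n) (X : Op N A n) :
    trSite D n j X = trAt D ⟨j, h⟩ X := by rw [trSite, dif_pos h]

/-- The quantum trace in the tensor factors `p, p + 1, …, p + l - 1`. -/
def trSeg (D : Matrix (Fin N) (Fin N) K) (n p : ℕ) : ℕ → (Op N A n →ₗ[K] Op N A n)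
  | 0 => LinearMap.id
  | l + 1 => trSeg D n p l ∘ₗ trSite D n (p + l)

theorem trSeg_succ (D : Matrix (Fin N) (Fin N) K) (n p l : ℕ) (X : Op N A n) :
    trSeg D n p (l + 1) X = trSeg D n p l (trSite D n (p + l) X) := rfl

theorem trSeg_add (D : Matrix (Fin N) (Fin N) K) (n p a b : ℕ) (X : Op N A n) :
    trSeg D n p (a + b) X = trSeg D n p a (trSeg D n (p + a) b X) := by
  induction b generalizing X with
  | zero => rfl
  | succ b ih => rw [← add_assoc, trSeg_succ, ih, trSeg_succ, add_assoc]

theorem trSeg_mul (D : Matrix (Fin N) (Fin N) K) {n p l : ℕ} {C : Op N A n}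
    (hC : ∀ j : Fin n, p ≤ j → (j : ℕ) < p + l → IsOff j C) (X : Op N A n) :
    trSeg D n p l (C * X) = C * trSeg D n p l X := by
  induction l generalizing X with
  | zero => rfl
  | succ l ih =>
    have ih := ih fun j h0 h1 => hC j h0 (by omega)
    by_cases h : p + l < n
    · rw [trSeg_succ, trSeg_succ, trSite_of_lt D h, trSite_of_lt D h,
        (hC ⟨p + l, h⟩ (by simp) (by simp)).trAt_mul, ih]
    · rw [trSeg_succ, trSeg_succ, trSite, dif_neg h, LinearMap.id_apply, LinearMap.id_apply, ih]

theorem trSeg_mul_right (D : Matrix (Fin N) (Fin N) K) {n p l : ℕ} {C : Op N A n}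
    (hC : ∀ j : Fin n, p ≤ j → (j : ℕ) < p + l → IsOff j C) (X : Op N A n) :
    trSeg D n p l (X * C) = trSeg D n p l X * C := by
  induction l generalizing X with
  | zero => rfl
  | succ l ih =>
    have ih := ih fun j h0 h1 => hC j h0 (by omega)
    by_cases h : p + l < n
    · rw [trSeg_succ, trSeg_succ, trSite_of_lt D h, trSite_of_lt D h,
        (hC ⟨p + l, h⟩ (by simp) (by simp)).trAt_mul_right, ih]
    · rw [trSeg_succ, trSeg_succ, trSite, dif_neg h, LinearMap.id_apply, LinearMap.id_apply, ih]

theorem trSeg_exchange {R F G Ψ : M2 N K} (hΨ : IsClosedPair F Ψ) (hc : Compatible R F)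
    (hFG : F * G = 1) {n i : ℕ} (h : i + 2 ≤ n) (X : Op N A n) :
    trSeg (Dmat Ψ) n 0 n (siteHom A h R * X) =
      trSeg (Dmat Ψ) n 0 n (X * siteHom A h (F * (F * R * G) * G)) := by
  have off (Y : M2 N K) (j : Fin n) (hj : 0 + i + 2 ≤ j) (_ : (j : ℕ) < 0 + i + 2 + (n - (i + 2))) :
      IsOff j (siteHom A h Y) := isOff_siteHom h Y (by omega) (by omega)
  have e (X : Op N A n) : trSeg (Dmat Ψ) n 0 n X = trSeg (Dmat Ψ) n 0 i
      (trAt (Dmat Ψ) ⟨i, by omega⟩ (trAt (Dmat Ψ) ⟨i + 1, by omega⟩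
        (trSeg (Dmat Ψ) n (0 + i + 2) (n - (i + 2)) X))) := by
    have hn : trSeg (Dmat Ψ) n 0 n X = trSeg (Dmat Ψ) n 0 (i + 2 + (n - (i + 2))) X := by
      rw [Nat.add_sub_of_le h]
    have h0 : 0 + i < n := by omega
    have h1 : 0 + (i + 1) < n := by omega
    have e0 : (⟨0 + i, h0⟩ : Fin n) = ⟨i, by omega⟩ := Fin.ext (Nat.zero_add i)
    have e1 : (⟨0 + (i + 1), h1⟩ : Fin n) = ⟨i + 1, by omega⟩ := Fin.ext (Nat.zero_add _)
    rw [hn, trSeg_add, trSeg_succ, trSeg_succ, trSite_of_lt _ h1, trSite_of_lt _ h0, e0, e1,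
      add_assoc]
  rw [e, e, trSeg_mul _ (off R), trSeg_mul_right _ (off _), trAt_trAt_exchange hΨ hc hFG h]

theorem trSeg_embed (D : Matrix (Fin N) (Fin N) K) {p k n a l : ℕ} (h : p + k ≤ n) (hl : a + l ≤ k)
    (X : Op N A k) :
    trSeg D n (p + a) l (embed K (shiftEmb h) X) = embed K (shiftEmb h) (trSeg D k a l X) := by
  induction l generalizing X with
  | zero => rfl
  | succ l ih =>
    rw [trSeg_succ, trSeg_succ, ← ih (by omega), trSite_of_lt D (by omega : a + l < k),
      trSite_of_lt D (by omega : p + a + l < n), ← trAt_embed]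
    congr 3
    exact Fin.ext (by simp [val_shiftEmb, add_assoc])

/-! ### The full quantum trace -/

theorem trAt_last (D : Matrix (Fin N) (Fin N) K) {n : ℕ} (X : Op N A (n + 1)) :
    trAt D (Fin.last n) X = embed K (shiftEmb (by omega : 0 + n ≤ n + 1)) (qtr1 D X) := by
  ext a b
  have hr (j : Fin (n + 1)) : j ∉ Set.range (shiftEmb (by omega : 0 + n ≤ n + 1)) ↔
      j = Fin.last n := by
    rw [mem_range_shiftEmb, Fin.ext_iff, Fin.val_last]; omega
  have e (c : Fin (n + 1) → Fin N) (x : Fin N) : update c (Fin.last n) x =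
      Fin.snoc (c ∘ shiftEmb (by omega : 0 + n ≤ n + 1)) x := by
    funext j
    refine Fin.lastCases ?_ (fun j => ?_) j
    · simp
    · rw [Fin.snoc_castSucc, update_of_ne (Fin.castSucc_lt_last j).ne, comp_apply]
      exact congrArg c (Fin.ext (Nat.zero_add _).symm)
  rw [trAt_apply, embed_apply]
  simp only [hr, forall_eq, qtr1, e, Algebra.smul_def]

theorem qtrAll_succ (D : Matrix (Fin N) (Fin N) K) {n : ℕ} (X : Op N A (n + 1)) :
    qtrAll D X = qtrAll D (qtr1 D X) := by
  have e (f : (Fin (n + 1) → Fin N) → A) : ∑ a, f a = ∑ a : Fin n → Fin N, ∑ x, f (Fin.snoc a x) := by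
    rw [← (Fin.snocEquiv fun _ => Fin N).sum_comp, Fintype.sum_prod_type, Finset.sum_comm]
    rfl
  simp only [qtrAll, qtr1, e, Fin.prod_univ_castSucc, Fin.snoc_castSucc, Fin.snoc_last,
    Finset.mul_sum, map_mul, mul_assoc]
  exact Finset.sum_congr rfl fun a _ => Finset.sum_comm

theorem embed_scalar {p k n : ℕ} (h : p + k ≤ n) (x : A) :
    embed K (shiftEmb h) (Matrix.scalar (Fin k → Fin N) x) = Matrix.scalar _ x := by
  ext a b
  rw [embed_apply, Matrix.scalar_apply, Matrix.scalar_apply, Matrix.diagonal_apply,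
    Matrix.diagonal_apply, ← ite_and]
  congr 1
  rw [eq_iff_iff]
  constructor
  · rintro ⟨h1, h2⟩
    funext j
    by_cases hj : j ∈ Set.range (shiftEmb h)
    · obtain ⟨i, rfl⟩ := hj
      exact congrFun h2 i
    · exact h1 j hj
  · rintro rfl
    simp

theorem trSeg_eq_scalar (D : Matrix (Fin N) (Fin N) K) {n : ℕ} (X : Op N A n) :
    trSeg D n 0 n X = Matrix.scalar _ (qtrAll D X) := by
  induction n with
  | zero =>
    ext a b
    obtain rfl := Subsingleton.elim a b
    rw [Matrix.scalar_apply, Matrix.diagonal_apply_eq, qtrAll, Fintype.sum_unique,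
      Fintype.sum_unique, Fin.prod_univ_zero, map_one, one_mul, Subsingleton.elim default a]
    rfl
  | succ n ih =>
    have hn : 0 + n < n + 1 := by omega
    have e : (⟨0 + n, hn⟩ : Fin (n + 1)) = Fin.last n := Fin.ext (Nat.zero_add n)
    have := trSeg_embed D (a := 0) (by omega : 0 + n ≤ n + 1) (by omega : 0 + n ≤ n) (qtr1 D X)
    rw [trSeg_succ, trSite_of_lt D hn, e, trAt_last, qtrAll_succ, ← embed_scalar (K := K)
      (by omega : 0 + n ≤ n + 1), ← ih, ← this]

theorem IsOff.ascProd {n : ℕ} {f : ℕ → Op N A n} {j : Fin n} {p l : ℕ}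
    (hf : ∀ i < l, IsOff j (f (p + i))) : IsOff j (ascProd f p l) := fun x y =>
  ascProd_commute fun i hi => hf i hi x y

theorem IsOff.descProd {n : ℕ} {f : ℕ → Op N A n} {j : Fin n} {p l : ℕ}
    (hf : ∀ i < l, IsOff j (f (p + i))) : IsOff j (descProd f p l) := fun x y =>
  descProd_commute fun i hi => hf i hi x y

variable (A) in
/-- The operator `X` with central entries placed at the tensor factors `i` and `i + 1`, as a
sequence in `i`. -/
def siteSeq (n : ℕ) (X : M2 N K) (i : ℕ) : Op N A n := site n i (X.map (algebraMap K A))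

theorem siteSeq_of_le {n i : ℕ} (h : i + 2 ≤ n) (X : M2 N K) : siteSeq A n X i = siteHom A h X :=
  (siteHom_apply h X).symm

theorem isOff_siteSeq {n i : ℕ} (h : i + 1 < n) (X : M2 N K) {j : Fin n} (hj : (j : ℕ) ≠ i)
    (hj' : (j : ℕ) ≠ i + 1) : IsOff j (siteSeq A n X i) := by
  rw [siteSeq_of_le h]
  exact isOff_siteHom _ X hj hj'

theorem trSeg_conj {F G Ψ : M2 N K} (hΨ : IsClosedPair F Ψ) (hF : YB F) (hFG : F * G = 1)
    {n p b : ℕ} (h : p + b < n) {X : Op N A n} (hX : ∀ j : Fin n, p + b ≤ j → IsOff j X) :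
    trSeg (Dmat Ψ) n (p + 1) b (ascProd (siteSeq A n F) p b * X * descProd (siteSeq A n G) p b) =
      trSeg (Dmat Ψ) n p b X := by
  induction b generalizing X with
  | zero => simp [trSeg, ascProd, descProd]
  | succ b ih =>
    have h2 : p + b + 2 ≤ n := by omega
    have h3 : p + 1 + b < n := by omega
    have e : (⟨p + 1 + b, h3⟩ : Fin n) = ⟨p + b + 1, by omega⟩ := Fin.ext (by simp; omega)
    have off (Y : M2 N K) (i : ℕ) (hi : i < b) :
        IsOff (⟨p + b + 1, by omega⟩ : Fin n) (siteSeq A n Y (p + i)) :=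
      isOff_siteSeq (by omega) Y (by simp; omega) (by simp; omega)
    have hX' : IsOff (⟨p + b + 1, by omega⟩ : Fin n) X := hX _ (by simp; omega)
    have hoff (j : Fin n) (hj : p + b ≤ j) :
        IsOff j (trAt (Dmat Ψ) (⟨p + b, by omega⟩ : Fin n) X) := by
      by_cases hjb : j = ⟨p + b, by omega⟩
      · rw [hjb, trAt_def]
        intro x y
        exact Commute.sum_left _ _ _ fun c _ => Commute.sum_left _ _ _ fun e _ =>
          (isOff_compAt K _ e c X x y).smul_left _
      · refine (hX j ?_).trAt_of_ne hjb _
        simp only [Fin.ext_iff] at hjb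
        omega
    have assoc (C Y X Z C' : Op N A n) : C * Y * X * (Z * C') = C * (Y * X * Z) * C' := by
      simp only [mul_assoc]
    rw [ascProd, descProd, trSeg_succ, trSeg_succ, trSite_of_lt _ h3,
      trSite_of_lt _ (by omega : p + b < n), ← ih (by omega) hoff, siteSeq_of_le h2,
      siteSeq_of_le h2, assoc, e, (IsOff.descProd (off G)).trAt_mul_right,
      (IsOff.ascProd (off F)).trAt_mul, trAt_conj hΨ hF hFG h2 hX']

end TraceSegment

section Copies

variable {K : Type*} [Field K] {A : Type*} [Ring A] [Algebra K A] {N : ℕ}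

theorem map_heckeAsym {B C : Type*} [Ring B] [Algebra K B] [Ring C] [Algebra K C]
    (f : B →ₐ[K] C) (q : K) (g : ℕ → B) (k : ℕ) :
    f (heckeAsym q g k) = heckeAsym q (fun i => f (g i)) k := by
  match k with
  | 0 => exact map_one f
  | 1 => exact map_one f
  | k + 2 => simp only [heckeAsym, map_smul, map_mul, map_sub, map_one, map_heckeAsym f q g (k + 1)]

theorem map_ascProd {B C : Type*} [Ring B] [Algebra K B] [Ring C] [Algebra K C]
    (f : B →ₐ[K] C) (M : ℕ → B) (p l : ℕ) :
    f (ascProd M p l) = ascProd (fun i => f (M i)) p l := by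
  induction l with
  | zero => exact map_one f
  | succ l ih => rw [ascProd, map_mul, ih, ascProd]

theorem ascProd_congr {B : Type*} [Ring B] {M M' : ℕ → B} {p l : ℕ}
    (h : ∀ i < l, M (p + i) = M' (p + i)) : ascProd M p l = ascProd M' p l := by
  induction l with
  | zero => rfl
  | succ l ih => rw [ascProd, ascProd, ih fun i hi => h i (by omega), h l (by omega)]

variable (F R : M2 N K) (M : Matrix (Fin N) (Fin N) A)

/-- The copies of the matrix `M` in the tensor factors, transported by `F`. -/
noncomputable def copySeq (n : ℕ) : ℕ → Op N A n :=
  Mbar n (F.map (algebraMap K A)) (F⁻¹.map (algebraMap K A)) M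

theorem copySeq_succ (n k : ℕ) : copySeq F M n (k + 1) =
    siteSeq A n F k * copySeq F M n k * siteSeq A n F⁻¹ k := rfl

theorem MbarSeg_eq_ascProd (n p l : ℕ) :
    MbarSeg n (F.map (algebraMap K A)) (F⁻¹.map (algebraMap K A)) M p l =
      ascProd (copySeq F M n) p l := by
  induction l with
  | zero => rfl
  | succ l ih => rw [MbarSeg, ih]; rfl

theorem embed_siteSeq {k n i : ℕ} (h : 0 + k ≤ n) (hi : i + 1 < k) :
    embed K (shiftEmb h) (siteSeq A k R i) = siteSeq A n R i := by
  rw [siteSeq, embed_site h hi, zero_add]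
  rfl

theorem embed_copySeq {k n i : ℕ} (h : 0 + k ≤ n) (hi : i < k) :
    embed K (shiftEmb h) (copySeq F M k i) = copySeq F M n i := by
  induction i with
  | zero => exact embed_site1 h hi M
  | succ i ih =>
    rw [copySeq_succ, map_mul, map_mul, embed_siteSeq F h hi, embed_siteSeq F⁻¹ h hi,
      ih (by omega), copySeq_succ]

theorem isOff_copySeq {n k : ℕ} {j : Fin n} (hj : k < j) : IsOff j (copySeq F M n k) := by
  rw [← embed_copySeq F M (by omega : 0 + (k + 1) ≤ n) (lt_add_one k)]
  exact isOff_embed (K := K) _ (by rw [mem_range_shiftEmb]; omega) _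

variable {F R}

theorem isCompatSeq_siteSeq {X : M2 N K}
    (hd : site 3 0 X * site 3 1 F * site 3 0 F = site 3 1 F * site 3 0 F * site 3 1 X)
    (hu : site 3 0 F * site 3 1 F * site 3 0 X = site 3 1 X * site 3 0 F * site 3 1 F) (n : ℕ) :
    IsCompatSeq n (siteSeq A n F) (copySeq F M n) (siteSeq A n X) where
  far i j hij hi hj := by
    rw [siteSeq_of_le hj]
    exact commute_siteHom hj X (isOff_siteSeq hi F (by simp; omega) (by simp; omega))
      (isOff_siteSeq hi F (by simp; omega) (by simp; omega))
  up i hi := by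
    rw [siteSeq_of_le hi, siteSeq_of_le (by omega), siteSeq_of_le hi, siteSeq_of_le (by omega)]
    exact siteHom_braid hu _ _
  down i hi := by
    rw [siteSeq_of_le hi, siteSeq_of_le (by omega), siteSeq_of_le hi, siteSeq_of_le (by omega)]
    exact siteHom_braid hd _ _
  commute_copy k j hkj hj := by
    rw [siteSeq_of_le hj]
    exact commute_siteHom hj X (isOff_copySeq F M hkj) (isOff_copySeq F M (by simp; omega))

theorem isBraidData_siteSeq (hF : IsUnit F) (hc : Compatible R F) (hM : IsGenerators R F M) (n : ℕ) :
    IsBraidData n (siteSeq A n F) (siteSeq A n F⁻¹) (siteSeq A n R) (copySeq F M n) where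
  FG i hi := by
    rw [siteSeq_of_le hi, siteSeq_of_le hi]
    exact siteHom_mul_eq_one (Matrix.mul_nonsing_inv _ ((Matrix.isUnit_iff_isUnit_det _).1 hF)) _
  GF i hi := by
    rw [siteSeq_of_le hi, siteSeq_of_le hi]
    exact siteHom_mul_eq_one (Matrix.nonsing_inv_mul _ ((Matrix.isUnit_iff_isUnit_det _).1 hF)) _
  F_compat := isCompatSeq_siteSeq M hc.2.1 hc.2.1 n
  R_compat := isCompatSeq_siteSeq M hc.2.2.1 hc.2.2.2 n
  copy_succ k _ := rfl
  generators hn := by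
    have h : 0 + 2 ≤ n := by omega
    have := congrArg (embed K (shiftEmb h)) hM
    rw [MbarSeg_eq_ascProd, map_mul, map_mul] at this
    have e : embed K (shiftEmb h) (ascProd (copySeq F M 2) 0 2) =
        copySeq F M n 0 * copySeq F M n 1 := by
      rw [map_ascProd, ascProd_congr fun i hi => embed_copySeq F M h (by omega)]
      simp [ascProd]
    rw [e] at this
    refine Eq.trans ?_ (this.trans ?_)
    · exact congrArg (· * _) (embed_siteSeq R h (by omega)).symm
    · refine congrArg (_ * ·) ((embed_siteSeq (RFF R F) h (by omega)).trans ?_)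
      simp only [siteSeq_of_le h, RFF, map_mul, mul_assoc]

/-! ### Symmetric functions -/

theorem isOff_heckeAsym {n : ℕ} {j : Fin n} {q : K} {g : ℕ → Op N A n} {k : ℕ}
    (hg : ∀ i, i + 1 < k → IsOff j (g i)) : IsOff j (heckeAsym q g k) := fun x y =>
  (SemiconjBy.heckeAsym fun i hi => (hg i hi x y).symm).symm

variable (F R)

theorem trSeg_heckeAsym_mul_zero (D : Matrix (Fin N) (Fin N) K) (Q : K) {n c : ℕ}
    (h : c ≤ n) :
    trSeg D n 0 c (heckeAsym Q (siteSeq A n R) c * ascProd (copySeq F M n) 0 c) =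
      Matrix.scalar _ (qtrAll D (heckeAsym Q (siteSeq A c R) c * ascProd (copySeq F M c) 0 c)) := by
  have h' : 0 + c ≤ n := by omega
  have e1 : embed K (shiftEmb h') (heckeAsym Q (siteSeq A c R) c) =
      heckeAsym Q (siteSeq A n R) c :=
    (map_heckeAsym (B := Op N A c) (C := Op N A n) (embed K (shiftEmb h')) Q _ c).trans
      (heckeAsym_congr fun i hi => embed_siteSeq R h' hi)
  have e2 : embed K (shiftEmb h') (ascProd (copySeq F M c) 0 c) = ascProd (copySeq F M n) 0 c :=
    (map_ascProd (B := Op N A c) (C := Op N A n) (embed K (shiftEmb h')) _ 0 c).trans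
      (ascProd_congr fun i hi => embed_copySeq F M h' (by omega))
  rw [← embed_scalar (K := K) h', ← trSeg_eq_scalar, ← trSeg_embed D h' (by omega),
    map_mul (embed K _), e1, e2]

variable {F R}

theorem trSeg_heckeAsym_mul {Ψ : M2 N K} (hF : IsUnit F) (hc : Compatible R F)
    (hΨ : IsClosedPair F Ψ) (hM : IsGenerators R F M) (Q : K) {n p b : ℕ} (h : p + b ≤ n) :
    trSeg (Dmat Ψ) n p b (heckeAsym Q (fun i => siteSeq A n R (p + i)) b *
        ascProd (copySeq F M n) p b) =
      Matrix.scalar _ (qtrAll (Dmat Ψ)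
        (heckeAsym Q (siteSeq A b R) b * ascProd (copySeq F M b) 0 b)) := by
  have hb := isBraidData_siteSeq M hF hc hM n
  induction p with
  | zero =>
    simp only [zero_add]
    exact trSeg_heckeAsym_mul_zero F R M _ Q (by omega)
  | succ p ih =>
    have hC : ascProd (siteSeq A n F) p b * descProd (siteSeq A n F⁻¹) p b = 1 :=
      ascProd_mul_descProd fun j hj => hb.FG _ (by omega)
    have h1 : SemiconjBy (ascProd (siteSeq A n F) p b)
        (heckeAsym Q (fun i => siteSeq A n R (p + i)) b)
        (heckeAsym Q (fun i => siteSeq A n R (p + 1 + i)) b) :=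
      SemiconjBy.heckeAsym fun i hi => IsBraidData.semiconj_chain hb.R_compat (by omega) hi
    have h2 : SemiconjBy (ascProd (siteSeq A n F) p b) (ascProd (copySeq F M n) p b)
        (ascProd (copySeq F M n) (p + 1) b) :=
      SemiconjBy.ascProd fun i hi => hb.semiconj_chain_copy (by omega) hi
    rw [← ih (by omega), ← trSeg_conj hΨ hc.2.1 (Matrix.mul_nonsing_inv _
      ((Matrix.isUnit_iff_isUnit_det _).1 hF)) (by omega : p + b < n), (h1.mul_right h2).eq,
      mul_assoc _ (ascProd (siteSeq A n F) p b), hC, mul_one]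
    intro j hj
    exact (isOff_heckeAsym fun i hi => isOff_siteSeq (by omega) R (by omega) (by omega)).mul
      (IsOff.ascProd fun i hi => isOff_copySeq F M (by omega))

theorem isOff_scalar {n : ℕ} (j : Fin n) (x : A) :
    IsOff j (Matrix.scalar (Fin n → Fin N) x) := fun z w => by
  ext a b
  rw [Matrix.scalar_apply, Matrix.diagonal_mul, Matrix.mul_diagonal, unitAt]
  split_ifs <;> simp

theorem trSeg_heckeAsym_mul_heckeAsym {Ψ : M2 N K} (hF : IsUnit F) (hc : Compatible R F)
    (hΨ : IsClosedPair F Ψ) (hM : IsGenerators R F M) (P Q : K) {n a b : ℕ} (h : n = a + b) :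
    trSeg (Dmat Ψ) n 0 n (heckeAsym P (siteSeq A n R) a *
        heckeAsym Q (fun i => siteSeq A n R (a + i)) b * ascProd (copySeq F M n) 0 n) =
      Matrix.scalar _
        (qtrAll (Dmat Ψ) (heckeAsym P (siteSeq A a R) a * ascProd (copySeq F M a) 0 a) *
          qtrAll (Dmat Ψ) (heckeAsym Q (siteSeq A b R) b * ascProd (copySeq F M b) 0 b)) := by
  have hb := isBraidData_siteSeq M hF hc hM n
  have hMM : ascProd (copySeq F M n) 0 n =
      ascProd (copySeq F M n) 0 a * ascProd (copySeq F M n) a b := by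
    have := ascProd_add (copySeq F M n) 0 a b
    rwa [← h, zero_add] at this
  have htr (X : Op N A n) : trSeg (Dmat Ψ) n 0 n X =
      trSeg (Dmat Ψ) n 0 a (trSeg (Dmat Ψ) n a b X) := by
    have := trSeg_add (Dmat Ψ) n 0 a b X
    rwa [← h, zero_add] at this
  have hcomm : Commute (ascProd (copySeq F M n) 0 a)
      (heckeAsym Q (fun i => siteSeq A n R (a + i)) b) := ascProd_commute fun k hk =>
    SemiconjBy.heckeAsym fun i hi => hb.R_compat.commute_copy _ _ (by omega) (by omega)
  have assoc (S T X Y : Op N A n) (hXT : Commute X T) : S * T * (X * Y) = S * X * (T * Y) := by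
    rw [mul_assoc, ← mul_assoc T, ← hXT.eq, mul_assoc X, ← mul_assoc]
  rw [hMM, htr, assoc _ _ _ _ hcomm, trSeg_mul, trSeg_heckeAsym_mul M hF hc hΨ hM Q (by omega),
    trSeg_mul_right _ fun j _ _ => isOff_scalar j _, trSeg_heckeAsym_mul_zero F R M _ P (by omega),
    map_mul]
  intro j hj _
  exact (isOff_heckeAsym fun i hi => isOff_siteSeq (by omega) R (by omega) (by omega)).mul
    (IsOff.ascProd fun i hi => isOff_copySeq F M (by omega))

theorem map_qasym (q : K) (m k : ℕ) : (qasym q R m 0 k).map (algebraMap K A) =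
    heckeAsym q (siteSeq A m R) k := by
  have e : qasym q R m 0 k = heckeAsym q (fun i => site m i R) k := by
    induction k using Nat.strong_induction_on with
    | _ k ih =>
      match k with
      | 0 => rfl
      | 1 => rfl
      | k + 2 => rw [qasym, ih (k + 1) (by omega), zero_add, heckeAsym]
  rw [e]
  refine (map_heckeAsym ((Algebra.ofId K A).mapMatrix : Op N K m →ₐ[K] Op N A m) q _ k).trans ?_
  exact congrArg (heckeAsym q · k) (funext fun i => site_map m i R)

theorem map_qsym {q : K} (h1 : qInt q 1 ≠ 0) (m k : ℕ) : (qsym q R m 0 k).map (algebraMap K A) =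
    heckeAsym (-q⁻¹) (siteSeq A m R) k := by
  have e : qsym q R m 0 k = heckeAsym (-q⁻¹) (fun i => site m i R) k := by
    induction k using Nat.strong_induction_on with
    | _ k ih =>
      match k with
      | 0 => rfl
      | 1 => rfl
      | k + 2 => rw [qsym, ih (k + 1) (by omega), zero_add, heckeAsym_neg_inv h1]
  rw [e]
  refine (map_heckeAsym ((Algebra.ofId K A).mapMatrix : Op N K m →ₐ[K] Op N A m) _ _ k).trans ?_
  exact congrArg (heckeAsym _ · k) (funext fun i => site_map m i R)

theorem isHeckeSeq_siteSeq {q : K} (hH : IsHecke q R) (n : ℕ) :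
    IsHeckeSeq q (siteSeq A (n + 1) R) n where
  quad i hi := by
    rw [siteSeq_of_le (by omega), ← map_mul, hH.2.2, map_add, map_one, map_smul]
  braid i hi := by
    rw [siteSeq_of_le (by omega), siteSeq_of_le (by omega)]
    exact siteHom_braid hH.2.1 _ _
  comm i j hij hj := by
    rw [siteSeq_of_le (by omega : j + 2 ≤ n + 1)]
    exact commute_siteHom _ R (isOff_siteSeq (by omega) R (by simp; omega) (by simp; omega))
      (isOff_siteSeq (by omega) R (by simp; omega) (by simp; omega))

theorem qtrAll_eq_zero (D : Matrix (Fin 0) (Fin 0) K) {n : ℕ} (hn : n ≠ 0) (X : Op 0 A n) :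
    qtrAll D X = 0 := by
  have : Nonempty (Fin n) := ⟨⟨0, Nat.pos_of_ne_zero hn⟩⟩
  rw [qtrAll, Fintype.sum_empty]

end Copies

/-- Wronski relations.  For a Hecke R-matrix `R̂`, a compatible
closed R-matrix `F̂` and a matrix of generators `M` of `M(R̂,F̂)`:  for every
`k = j+1 ≥ 1`,  `∑_{i=0}^{k} (−1)^i τ_{k−i}(M) σ_i(M) = 0` in `A`. -/
theorem Wronski_relations {K : Type} [Field K] {A : Type} [Ring A] [Algebra K A]
    {N : ℕ} (q : K) (R F Ψ : M2 N K) (M : Matrix (Fin N) (Fin N) A)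
    (hq0 : q ≠ 0) (hq1 : q ^ 2 ≠ 1) (hqn : ∀ n : ℕ, 1 ≤ n → qInt q n ≠ 0)
    (hH : IsHecke q R) (hF : IsUnit F) (hΨ : IsClosedPair F Ψ)
    (h : Compatible R F) (hM : IsGenerators R F M) :
    ∀ j : ℕ,
      ∑ i ∈ Finset.range (j + 2),
        ((-1 : K) ^ i) • (tauF q R F Ψ M (j + 1 - i) * sigmaF q R F Ψ M i) =
      (0 : A) := by
  intro j
  obtain rfl | hN := Nat.eq_zero_or_pos N
  · refine Finset.sum_eq_zero fun i hi => ?_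
    obtain rfl | hi0 := eq_or_ne i 0
    · rw [tauF, qtrAll_eq_zero _ (by omega), zero_mul, smul_zero]
    · rw [sigmaF, qtrAll_eq_zero _ hi0, mul_zero, smul_zero]
  have hb := isBraidData_siteSeq M hF h hM (j + 1)
  have hFG : F * F⁻¹ = 1 := Matrix.mul_nonsing_inv _ ((Matrix.isUnit_iff_isUnit_det _).1 hF)
  have key := (isHeckeSeq_siteSeq (A := A) hH j).trace_wronski hq0 hqn
    (trSeg (Dmat Ψ) (j + 1) 0 (j + 1) ∘ₗ
      LinearMap.mulRight K (ascProd (copySeq F M (j + 1)) 0 (j + 1))) fun i hi X => by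
    have hi' : i + 2 ≤ j + 1 := by omega
    have e := hb.generators_ascProd (by omega : i + 1 < j + 1) le_rfl
    simp only [LinearMap.comp_apply, LinearMap.mulRight_apply]
    rw [mul_assoc X, e, siteSeq_of_le hi', siteSeq_of_le hi', siteSeq_of_le hi', mul_assoc,
      trSeg_exchange hΨ h hFG hi']
    simp only [map_mul, mul_assoc]
  have hs : ∀ i ∈ Finset.range (j + 2), (-1 : K) ^ i • (trSeg (Dmat Ψ) (j + 1) 0 (j + 1) ∘ₗ
      LinearMap.mulRight K (ascProd (copySeq F M (j + 1)) 0 (j + 1)))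
        (heckeAsym (-q⁻¹) (siteSeq A (j + 1) R) (j + 1 - i) *
          heckeAsym q (fun t => siteSeq A (j + 1) R (j + 1 - i + t)) i) =
      Matrix.scalar (Fin (j + 1) → Fin N)
        ((-1 : K) ^ i • (tauF q R F Ψ M (j + 1 - i) * sigmaF q R F Ψ M i)) := by
    intro i hi
    rw [Finset.mem_range] at hi
    rw [tauF, sigmaF, map_qasym, map_qsym (hqn 1 le_rfl), MbarSeg_eq_ascProd, MbarSeg_eq_ascProd,
      LinearMap.comp_apply, LinearMap.mulRight_apply,
      trSeg_heckeAsym_mul_heckeAsym M hF h hΨ hM _ _ (by omega)]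
    ext a b
    rw [Matrix.smul_apply, Matrix.scalar_apply, Matrix.scalar_apply, Matrix.diagonal_apply,
      Matrix.diagonal_apply, smul_ite, smul_zero]
  rw [Finset.sum_congr rfl hs, ← map_sum] at key
  have : Nonempty (Fin N) := ⟨⟨0, hN⟩⟩
  exact Matrix.scalar_inj.1 (key.trans (map_zero _).symm)

end CHN
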